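/- arXiv:2007.09275 — 2 statements merged into one kernel-verified Lean document; each statement's English description precedes it below -/
import Mathlib

section
/- Let a and b be real numbers with a > 0 and b > max{a, 2−a}, and let σ be a real number with max{1 − (b−a)/2, 0} < σ < min{a, 1}. Then there is a constant C = C(a, b, σ) such that for every real number t and every positive integer n, | Σ over positive integers d of d^{a−b−2(σ+it)} · Σ over pairs (e₁, e₂) with 1 ≤ e₁, e₂ ≤ d and e₁e₂ ≡ n (mod d) of ζ(σ+it−a, e₁/d)·ζ(σ+it, e₂/d) | ≤ C·(1+|t|)^{a − (3σ)/2 + 1}. -/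
open Finset Complex

/-- The Hurwitz zeta function `ζ(s, x)` for `x ∈ (0, 1]` (analytic continuation of
`∑_{n ≥ 0} (n + x)^{-s}`); note that `ζ(s, 1) = ζ(s)`. -/
noncomputable def hzeta (s : ℂ) (x : ℝ) : ℂ := HurwitzZeta.hurwitzZeta (x : UnitAddCircle) s


lemma lu_concave (t : ℝ) : ConcaveOn ℝ (Set.Ioi (0:ℝ)) (fun y : ℝ => Real.log y - Real.log (y^2+t^2) / 2) := by
  have hd : ∀ y ∈ Set.Ioi (0:ℝ), HasDerivAt (fun y : ℝ => Real.log y - Real.log (y^2+t^2) / 2) (t^2/(y*(y^2+t^2))) y := by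
    intro y hy
    have hy : 0 < y := hy
    have h1 := Real.hasDerivAt_log hy.ne'
    have h2 : HasDerivAt (fun y : ℝ => y^2+t^2) (2*y) y := by
      simpa using (hasDerivAt_pow 2 y).add_const (t^2)
    have h3 := (h2.log (by positivity)).div_const 2
    refine (h1.sub h3).congr_deriv ?_
    field_simp
    ring
  apply AntitoneOn.concaveOn_of_deriv (convex_Ioi 0)
  · exact fun y hy => (hd y hy).continuousAt.continuousWithinAt
  · rw [interior_Ioi]; exact fun y hy => (hd y hy).differentiableAt.differentiableWithinAt
  · rw [interior_Ioi]
    intro x hx y hy hxy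
    rw [(hd x hx).deriv, (hd y hy).deriv]
    have hx : 0 < x := hx
    have hy : 0 < y := hy
    gcongr

lemma u_ineq (t σ p μ : ℝ) (hσ : 0 < σ) (hμ : 0 ≤ μ) (hp : p = σ + μ) :
    (σ / Real.sqrt (σ^2+t^2)) * (((p+1) / Real.sqrt ((p+1)^2+t^2)) ^ μ) ≤ (p / Real.sqrt (p^2+t^2)) ^ (1+μ) := by
  have hp0 : 0 < p := by linarith
  have hc := (lu_concave t).2
  have h := hc (show σ ∈ Set.Ioi (0:ℝ) from hσ) (show p + 1 ∈ Set.Ioi (0:ℝ) from (by show (0:ℝ) < p + 1; linarith))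
    (show 0 ≤ 1/(1+μ) by positivity) (show 0 ≤ μ/(1+μ) by positivity) (by field_simp)
  have e : (1/(1+μ)) • σ + (μ/(1+μ)) • (p+1) = p := by
    simp only [smul_eq_mul]; field_simp; rw [hp]; ring
  rw [e] at h
  simp only [smul_eq_mul] at h
  have h' : (Real.log σ - Real.log (σ^2+t^2)/2) + μ * (Real.log (p+1) - Real.log ((p+1)^2+t^2)/2) ≤ (1+μ) * (Real.log p - Real.log (p^2+t^2)/2) := by
    have := mul_le_mul_of_nonneg_left h (by linarith : 0 ≤ 1+μ)
    refine le_trans (le_of_eq ?_) this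
    field_simp
  have key : ∀ y : ℝ, 0 < y → y / Real.sqrt (y^2+t^2) = Real.exp (Real.log y - Real.log (y^2+t^2)/2) := by
    intro y hy
    rw [Real.exp_sub, Real.exp_log hy, ← Real.log_sqrt (by positivity), Real.exp_log (by positivity)]
  rw [key σ hσ, key p hp0, key (p+1) (by linarith), ← Real.exp_mul, ← Real.exp_mul, ← Real.exp_add]
  apply Real.exp_le_exp.mpr
  linarith

lemma norm_add_I (y t : ℝ) : ‖(y:ℂ) + t * I‖ = Real.sqrt (y^2+t^2) := by
  rw [Complex.norm_add_mul_I]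

lemma gseq_ratio (y t : ℝ) (hy : 0 < y) (n : ℕ) (hn : 0 < n):
    ‖Complex.GammaSeq ((y:ℂ)+t*I) n‖ / Real.GammaSeq y n = ∏ j ∈ Finset.range (n+1), ((y+j) / Real.sqrt ((y+j)^2+t^2)) := by
  unfold Complex.GammaSeq Real.GammaSeq
  rw [norm_div, norm_mul, norm_prod, Finset.prod_div_distrib]
  have : ∀ j ∈ Finset.range (n+1), ‖(y:ℂ)+t*I + j‖ = Real.sqrt ((y+j)^2+t^2) := by
    intro j _
    rw [← norm_add_I]; congr 1; push_cast; ring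
  rw [Finset.prod_congr rfl this]
  have e1 : ‖((n:ℂ)) ^ ((y:ℂ)+t*I)‖ = (n:ℝ)^y := by
    rw [Complex.norm_natCast_cpow_of_pos hn]; simp
  rw [e1, Complex.norm_natCast]
  have : 0 < ∏ j ∈ Finset.range (n+1), (y+(j:ℝ)) := Finset.prod_pos (fun j _ => by positivity)
  have : 0 < ∏ j ∈ Finset.range (n+1), Real.sqrt ((y+(j:ℝ))^2+t^2) := Finset.prod_pos (fun j _ => by positivity)
  have : (0:ℝ) < (n:ℝ)^y := by positivity
  have : (0:ℝ) < (n.factorial:ℝ) := by positivity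
  field_simp

lemma gseq_ineq (t σ p μ : ℝ) (hσ : 0 < σ) (hμ : 0 ≤ μ) (hp : p = σ + μ) :
    (‖Complex.Gamma ((σ:ℂ)+t*I)‖ / Real.Gamma σ) * (‖Complex.Gamma (((p+1:ℝ):ℂ)+t*I)‖ / Real.Gamma (p+1)) ^ μ ≤ (‖Complex.Gamma ((p:ℂ)+t*I)‖ / Real.Gamma p) ^ (1+μ) := by
  have hp0 : 0 < p := by linarith
  have T : ∀ y : ℝ, 0 < y → Filter.Tendsto (fun n => ‖Complex.GammaSeq ((y:ℂ)+t*I) n‖ / Real.GammaSeq y n) Filter.atTop (nhds (‖Complex.Gamma ((y:ℂ)+t*I)‖ / Real.Gamma y)) := by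
    intro y hy
    exact (Complex.GammaSeq_tendsto_Gamma _).norm.div (Real.GammaSeq_tendsto_Gamma y) (Real.Gamma_pos_of_pos hy).ne'
  refine le_of_tendsto_of_tendsto ((T σ hσ).mul ((T (p+1) (by linarith)).rpow_const (Or.inr hμ))) ((T p hp0).rpow_const (Or.inr (by linarith))) ?_
  filter_upwards [Filter.eventually_gt_atTop 0] with n hn
  rw [gseq_ratio σ t hσ n hn, gseq_ratio (p+1) t (by linarith) n hn, gseq_ratio p t hp0 n hn]
  rw [← Real.finsetProd_rpow _ _ (fun j _ => by positivity), ← Real.finsetProd_rpow _ _ (fun j _ => by positivity), ← Finset.prod_mul_distrib]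
  apply Finset.prod_le_prod
  · intro j _; positivity
  · intro j _
    have := u_ineq t (σ+j) (p+j) μ (by positivity) hμ (by rw [hp]; ring)
    rw [show p + 1 + (j:ℝ) = p + j + 1 by ring]
    exact this

lemma gamma_ext (t σ p μ : ℝ) (hσ : 0 < σ) (hμ : 0 ≤ μ) (hp : p = σ + μ) :
    ‖Complex.Gamma ((σ:ℂ)+t*I)‖ ≤ (Real.Gamma σ / Real.Gamma p * p ^ μ) * (‖Complex.Gamma ((p:ℂ)+t*I)‖ * (Real.sqrt (p^2+t^2)) ^ (-μ)) := by
  have hp0 : 0 < p := by linarith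
  have h := gseq_ineq t σ p μ hσ hμ hp
  have hne : (p:ℂ)+t*I ≠ 0 := by
    intro h; have := congrArg Complex.re h; simp at this; linarith
  have e1 : Complex.Gamma (((p+1:ℝ):ℂ)+t*I) = ((p:ℂ)+t*I) * Complex.Gamma ((p:ℂ)+t*I) := by
    rw [← Complex.Gamma_add_one _ hne]; congr 1; push_cast; ring
  rw [e1, Real.Gamma_add_one hp0.ne', norm_mul, norm_add_I] at h
  have g1 : 0 < ‖Complex.Gamma ((p:ℂ)+t*I)‖ := by
    rw [norm_pos_iff]; apply Complex.Gamma_ne_zero_of_re_pos; simpa using hp0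
  have g2 := Real.Gamma_pos_of_pos hp0
  have g3 := Real.Gamma_pos_of_pos hσ
  set A := ‖Complex.Gamma ((p:ℂ)+t*I)‖
  set B := Real.Gamma p
  set S := Real.sqrt (p^2+t^2)
  have hS : 0 < S := by positivity
  rw [show S * A / (p*B) = (S/p) * (A/B) by field_simp, Real.mul_rpow (by positivity) (by positivity), Real.rpow_add (by positivity), Real.rpow_one, Real.div_rpow hS.le hp0.le] at h
  have hq : 0 < (A/B)^μ := by positivity
  rw [← mul_assoc] at h
  have h2 := le_of_mul_le_mul_right h hq
  rw [Real.rpow_neg hS.le]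
  have h3 : 0 < S^μ := by positivity
  have h4 : 0 < p^μ := by positivity
  rw [div_mul_div_comm, div_le_div_iff₀ (by positivity) (by positivity)] at h2
  have : ‖Complex.Gamma ((σ:ℂ)+t*I)‖ = (‖Complex.Gamma ((σ:ℂ)+t*I)‖ * S^μ * B) / (S^μ * B) := by field_simp
  rw [this, div_le_iff₀ (by positivity)]
  refine h2.trans (le_of_eq ?_)
  field_simp

lemma gamma_half (t : ℝ) : ‖Complex.Gamma (((1/2:ℝ):ℂ)+t*I)‖ * Real.exp (Real.pi*|t|/2) ≤ Real.sqrt (2*Real.pi) := by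
  have h := Complex.Gamma_mul_Gamma_one_sub (((1/2:ℝ):ℂ)+t*I)
  have e1 : 1 - (((1/2:ℝ):ℂ)+t*I) = (starRingEnd ℂ) (((1/2:ℝ):ℂ)+t*I) := by
    apply Complex.ext <;> simp; norm_num
  have e2 : Complex.sin (Real.pi * (((1/2:ℝ):ℂ)+t*I)) = (Real.cosh (Real.pi*t) : ℝ) := by
    rw [show (Real.pi:ℂ) * (((1/2:ℝ):ℂ)+t*I) = (Real.pi*t:ℝ)*I + Real.pi/2 by push_cast; ring, Complex.sin_add_pi_div_two, Complex.cos_mul_I]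
    push_cast; rfl
  rw [e1, Complex.Gamma_conj, e2, Complex.mul_conj] at h
  have h2 : Complex.normSq (Complex.Gamma (((1/2:ℝ):ℂ)+t*I)) = Real.pi / Real.cosh (Real.pi*t) := by exact_mod_cast h
  rw [Complex.normSq_eq_norm_sq] at h2
  apply Real.le_sqrt_of_sq_le
  rw [mul_pow, h2, ← Real.exp_nat_mul]
  have hc : Real.exp (Real.pi*|t|) ≤ 2 * Real.cosh (Real.pi*t) := by
    rw [← Real.cosh_abs, abs_mul, abs_of_pos Real.pi_pos, Real.cosh_eq]
    have := Real.exp_pos (-(Real.pi*|t|))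
    linarith
  have := Real.cosh_pos (Real.pi*t)
  rw [show ((2:ℕ):ℝ) * (Real.pi*|t|/2) = Real.pi*|t| by push_cast; ring, div_mul_eq_mul_div, div_le_iff₀ this]
  nlinarith [Real.pi_pos]

lemma gamma_half_nat (m : ℕ) : ∃ C : ℝ, 0 ≤ C ∧ ∀ t : ℝ, ‖Complex.Gamma (((m + 1/2:ℝ):ℂ)+t*I)‖ * Real.exp (Real.pi*|t|/2) ≤ C * (1+|t|)^m := by
  induction m with
  | zero => exact ⟨Real.sqrt (2*Real.pi), by positivity, fun t => by simpa using gamma_half t⟩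
  | succ m ih =>
    obtain ⟨C, hC0, hC⟩ := ih
    refine ⟨(m+1)*C, by positivity, fun t => ?_⟩
    have hne : (((m + 1/2:ℝ):ℂ)+t*I) ≠ 0 := by
      intro h; have := congrArg Complex.re h; simp at this; 
      have : (0:ℝ) ≤ m := by positivity
      linarith
    have e1 : Complex.Gamma ((((m+1:ℕ) + 1/2:ℝ):ℂ)+t*I) = (((m + 1/2:ℝ):ℂ)+t*I) * Complex.Gamma (((m + 1/2:ℝ):ℂ)+t*I) := by
      rw [← Complex.Gamma_add_one _ hne]; congr 1; push_cast; ring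
    rw [e1, norm_mul, mul_assoc, pow_succ]
    have h1 : ‖(((m + 1/2:ℝ):ℂ)+t*I)‖ ≤ (m+1)*(1+|t|) := by
      refine (norm_add_le _ _).trans ?_
      rw [norm_mul, Complex.norm_I, Complex.norm_real, Complex.norm_real, Real.norm_eq_abs, Real.norm_eq_abs, abs_of_nonneg (by positivity)]
      have : (0:ℝ) ≤ m := by positivity
      nlinarith [abs_nonneg t]
    calc _ ≤ ((m+1)*(1+|t|)) * (C * (1+|t|)^m) := by
          apply mul_le_mul h1 (hC t) (by positivity) (by positivity)
      _ = _ := by ring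

lemma gamma_bound (σ : ℝ) (hσ : 0 < σ) : ∃ C : ℝ, 0 ≤ C ∧ ∀ t : ℝ, ‖Complex.Gamma ((σ:ℂ)+t*I)‖ * Real.exp (Real.pi*|t|/2) ≤ C * (1+|t|)^(σ-1/2) := by
  obtain ⟨m, hm⟩ := exists_nat_ge (σ + 1)
  obtain ⟨C, hC0, hC⟩ := gamma_half_nat m
  set p : ℝ := m + 1/2 with hp
  have hp1 : 1 ≤ p := by linarith
  set μ := p - σ with hμ
  have hμ0 : 0 ≤ μ := by linarith
  have hg := Real.Gamma_pos_of_pos hσ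
  have hg2 := Real.Gamma_pos_of_pos (by linarith : 0 < p)
  refine ⟨(Real.Gamma σ / Real.Gamma p * p ^ μ) * C * 2^μ, by positivity, fun t => ?_⟩
  have h1 := gamma_ext t σ p μ hσ hμ0 (by ring)
  have h2 : (1+|t|)/2 ≤ Real.sqrt (p^2+t^2) := by
    apply Real.le_sqrt_of_sq_le
    rw [← sq_abs t]
    nlinarith [abs_nonneg t, sq_nonneg (1-|t|)]
  have h3 : (Real.sqrt (p^2+t^2))^(-μ) ≤ 2^μ * (1+|t|)^(-μ) := by
    calc _ ≤ ((1+|t|)/2)^(-μ) := Real.rpow_le_rpow_of_nonpos (by positivity) h2 (by linarith)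
      _ = _ := by
        rw [Real.div_rpow (by positivity) (by norm_num), Real.rpow_neg (by norm_num : (0:ℝ) ≤ 2)]
        field_simp
  have e : (1+|t|)^(σ-1/2) = (1+|t|)^m * (1+|t|)^(-μ) := by
    rw [← Real.rpow_natCast, ← Real.rpow_add (by positivity)]; congr 1; rw [hμ, hp]; ring
  rw [e]
  calc _ ≤ (Real.Gamma σ / Real.Gamma p * p ^ μ) * (‖Complex.Gamma ((p:ℂ)+t*I)‖ * (Real.sqrt (p^2+t^2)) ^ (-μ)) * Real.exp (Real.pi*|t|/2) := by gcongr
    _ = (Real.Gamma σ / Real.Gamma p * p ^ μ) * ((‖Complex.Gamma ((p:ℂ)+t*I)‖ * Real.exp (Real.pi*|t|/2)) * (Real.sqrt (p^2+t^2)) ^ (-μ))  := by ring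
    _ ≤ (Real.Gamma σ / Real.Gamma p * p ^ μ) * ((C * (1+|t|)^m) * (2^μ * (1+|t|)^(-μ))) := by
        refine mul_le_mul_of_nonneg_left ?_ (by positivity)
        exact mul_le_mul (hC t) h3 (by positivity) (by positivity)
    _ = _ := by ring


lemma expZeta_bd (ρ : ℝ) (hρ : 1 < ρ) (x t : ℝ) : ‖HurwitzZeta.expZeta (x:UnitAddCircle) ((ρ:ℂ) + t*I)‖ ≤ ∑' n : ℕ, 1 / (n:ℝ)^ρ := by
  have h := HurwitzZeta.hasSum_expZeta_of_one_lt_re x (s := (ρ:ℂ)+t*I) (by simpa using hρ)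
  rw [← h.tsum_eq]
  apply tsum_of_norm_bounded (Real.summable_one_div_nat_rpow.mpr hρ).hasSum
  intro n
  rw [norm_div]
  have e : ‖cexp (2 * Real.pi * I * x * n)‖ = 1 := by
    rw [show (2 * Real.pi * I * x * n : ℂ) = ((2*Real.pi*x*n:ℝ):ℂ) * I by push_cast; ring, Complex.norm_exp_ofReal_mul_I]
  rw [e]
  rcases Nat.eq_zero_or_pos n with rfl | hn
  · rw [Nat.cast_zero, Complex.zero_cpow]
    · simp; positivity
    · intro h; have := congrArg Complex.re h; simp at this; linarith
  · rw [Complex.norm_natCast_cpow_of_pos hn]; simp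

lemma hz_neg (ρ : ℝ) (hρ : ρ < 0) : ∃ C : ℝ, 0 ≤ C ∧ ∀ t x : ℝ,
    ‖HurwitzZeta.hurwitzZeta (x:UnitAddCircle) ((ρ:ℂ) + t*I)‖ ≤ C * (1+|t|)^(1/2-ρ) := by
  obtain ⟨C, hC0, hC⟩ := gamma_bound (1-ρ) (by linarith)
  set Z := ∑' n : ℕ, 1 / (n:ℝ)^(1-ρ) with hZ
  have hZ0 : 0 ≤ Z := tsum_nonneg (fun n => by positivity)
  refine ⟨(2*Real.pi)^(-(1-ρ)) * C * (2*Z), by positivity, fun t x => ?_⟩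
  set s : ℂ := ((1-ρ:ℝ):ℂ) + ((-t:ℝ):ℂ)*I with hs
  have hsre : s.re = 1-ρ := by simp [hs]
  have hsim : s.im = -t := by simp [hs]
  have e0 : (ρ:ℂ)+t*I = 1 - s := by rw [hs]; push_cast; ring
  rw [e0, HurwitzZeta.hurwitzZeta_one_sub]
  rotate_left
  · intro n h; have := congrArg Complex.re h; rw [hsre] at this; simp at this
    have : (0:ℝ) ≤ n := by positivity
    linarith
  · right; intro h; have := congrArg Complex.re h; rw [hsre] at this; simp at this; linarith
  have b1 := expZeta_bd (1-ρ) (by linarith) x (-t)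
  have b2 := expZeta_bd (1-ρ) (by linarith) (-x) (-t)
  rw [← hs, ← hZ] at b1 b2
  have e2 : (((-x:ℝ):ℝ):UnitAddCircle) = -(x:UnitAddCircle) := by simp
  rw [e2] at b2
  have g := hC (-t)
  rw [← hs, abs_neg] at g
  have hx1 : ‖cexp (-Real.pi * I * s / 2)‖ ≤ Real.exp (Real.pi*|t|/2) := by
    rw [Complex.norm_exp]
    apply Real.exp_le_exp.mpr
    have : (-Real.pi * I * s / 2 : ℂ).re = -(Real.pi * t) / 2 := by
      rw [show (-Real.pi * I * s / 2 : ℂ) = ((-Real.pi/2:ℝ):ℂ) * (I * s) by push_cast; ring, Complex.re_ofReal_mul, Complex.I_mul_re, hsim]; ring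
    rw [this]
    nlinarith [neg_abs_le t, Real.pi_pos]
  have hx2 : ‖cexp (Real.pi * I * s / 2)‖ ≤ Real.exp (Real.pi*|t|/2) := by
    rw [Complex.norm_exp]
    apply Real.exp_le_exp.mpr
    have : (Real.pi * I * s / 2 : ℂ).re = (Real.pi * t) / 2 := by
      rw [show (Real.pi * I * s / 2 : ℂ) = ((Real.pi/2:ℝ):ℂ) * (I * s) by push_cast; ring, Complex.re_ofReal_mul, Complex.I_mul_re, hsim]; ring
    rw [this]
    nlinarith [le_abs_self t, Real.pi_pos]
  have hp : ‖(2*Real.pi:ℂ)^(-s)‖ = (2*Real.pi)^(-(1-ρ)) := by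
    rw [show (2*Real.pi:ℂ) = ((2*Real.pi:ℝ):ℂ) by push_cast; rfl, Complex.norm_cpow_eq_rpow_re_of_pos (by positivity)]
    simp [hsre]
  rw [norm_mul, norm_mul, hp]
  have hsum : ‖cexp (-Real.pi * I * s / 2) * HurwitzZeta.expZeta (x:UnitAddCircle) s + cexp (Real.pi * I * s / 2) * HurwitzZeta.expZeta (-(x:UnitAddCircle)) s‖ ≤ Real.exp (Real.pi*|t|/2) * (2*Z) := by
    refine (norm_add_le _ _).trans ?_
    rw [norm_mul, norm_mul]
    have := mul_le_mul hx1 b1 (norm_nonneg _) (by positivity)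
    have := mul_le_mul hx2 b2 (norm_nonneg _) (by positivity)
    linarith
  calc _ ≤ (2*Real.pi)^(-(1-ρ)) * ‖Complex.Gamma s‖ * (Real.exp (Real.pi*|t|/2) * (2*Z)) := by gcongr
    _ = (2*Real.pi)^(-(1-ρ)) * (‖Complex.Gamma s‖ * Real.exp (Real.pi*|t|/2)) * (2*Z) := by ring
    _ ≤ (2*Real.pi)^(-(1-ρ)) * (C * (1+|t|)^(1-ρ-1/2)) * (2*Z) := by gcongr
    _ = _ := by rw [show 1-ρ-1/2 = 1/2-ρ by ring]; ring


lemma kl_sin (θ u : ℝ) (hθ : 0 < θ) (h1 : θ ≤ u) (h2 : u ≤ 1 - θ) : 2*θ ≤ Real.sin (Real.pi*u) := by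
  have hpi := Real.pi_pos
  rcases le_total u (1/2) with h | h
  · have := Real.mul_le_sin (x := Real.pi*u) (by nlinarith) (by nlinarith)
    rw [show 2/Real.pi*(Real.pi*u) = 2*u by field_simp] at this
    linarith
  · have := Real.mul_le_sin (x := Real.pi*(1-u)) (by nlinarith) (by nlinarith)
    rw [show 2/Real.pi*(Real.pi*(1-u)) = 2*(1-u) by field_simp, show Real.pi*(1-u) = Real.pi - Real.pi*u by ring, Real.sin_pi_sub] at this
    linarith

lemma kl_abel (c z : ℕ → ℂ) (L : ℕ) (h : ∀ i ≤ L, z i = c i * (z i - z (i+1))) :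
    ∑ i ∈ range (L+1), z i = c 0 * z 0 - c L * z (L+1) + ∑ i ∈ range L, (c (i+1) - c i) * z (i+1) := by
  induction L with
  | zero => simp; linear_combination h 0 le_rfl
  | succ L ih =>
    rw [sum_range_succ, ih (fun i hi => h i (by omega)), sum_range_succ]
    linear_combination h (L+1) le_rfl

/-- Kusmin-Landau. -/
lemma kl0 (f : ℕ → ℝ) (L : ℕ) (k : ℤ) (θ : ℝ) (hθ : 0 < θ)
    (h1 : ∀ i ≤ L, k + θ ≤ f (i+1) - f i) (h2 : ∀ i ≤ L, f (i+1) - f i ≤ k + 1 - θ)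
    (hm : ∀ i < L, f (i+2) - f (i+1) ≤ f (i+1) - f i) :
    ‖∑ i ∈ range (L+1), cexp (2*Real.pi*f i*I)‖ ≤ 1/θ := by
  have hpi := Real.pi_pos
  set u : ℕ → ℝ := fun i => f (i+1) - f i - k with hu
  set κ : ℕ → ℝ := fun i => Real.cos (Real.pi * u i) / Real.sin (Real.pi * u i) with hκ
  set c : ℕ → ℂ := fun i => 1/2 + (I/2) * (κ i : ℂ) with hc
  set z : ℕ → ℂ := fun i => cexp (2*Real.pi*f i*I) with hz
  have hu1 : ∀ i ≤ L, θ ≤ u i := fun i hi => by have := h1 i hi; simp only [hu]; linarith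
  have hu2 : ∀ i ≤ L, u i ≤ 1 - θ := fun i hi => by have := h2 i hi; simp only [hu]; linarith
  have hs : ∀ i ≤ L, 2*θ ≤ Real.sin (Real.pi * u i) := fun i hi => kl_sin θ _ hθ (hu1 i hi) (hu2 i hi)
  have hz1 : ∀ i, ‖z i‖ = 1 := fun i => by
    simp only [hz]
    rw [show (2*Real.pi*f i*I:ℂ) = ((2*Real.pi*f i:ℝ):ℂ)*I by push_cast; ring, Complex.norm_exp_ofReal_mul_I]
  have hrec : ∀ i ≤ L, z i = c i * (z i - z (i+1)) := by
    intro i hi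
    have hsi : Real.sin (Real.pi * u i) ≠ 0 := by have := hs i hi; linarith
    have e1 : z (i+1) = z i * (cexp ((Real.pi * u i : ℝ) * I))^2 := by
      simp only [hz]
      rw [← Complex.exp_nat_mul, ← Complex.exp_add]
      rw [Complex.exp_eq_exp_iff_exists_int]
      refine ⟨k, ?_⟩
      simp only [hu]; push_cast; ring
    have e2 : cexp ((Real.pi * u i : ℝ) * I) = (Real.cos (Real.pi * u i) : ℂ) + (Real.sin (Real.pi * u i) : ℂ) * I := by
      rw [Complex.exp_mul_I]; push_cast; rfl
    have e3 : c i * (1 - (cexp ((Real.pi * u i : ℝ) * I))^2) = 1 := by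
      rw [e2]
      simp only [hc, hκ]
      have hcs : (Real.cos (Real.pi * u i) : ℂ)^2 + (Real.sin (Real.pi * u i) : ℂ)^2 = 1 := by
        exact_mod_cast Real.cos_sq_add_sin_sq (Real.pi * u i)
      have hsi' : (Real.sin (Real.pi * u i) : ℂ) ≠ 0 := by exact_mod_cast hsi
      rw [Complex.ofReal_div]
      generalize (Real.cos (Real.pi * u i) : ℂ) = C at *
      generalize (Real.sin (Real.pi * u i) : ℂ) = S at *
      field_simp
      have hI : I^2 = -1 := Complex.I_sq
      have hI3 : I^3 = -I := by rw [pow_succ, hI]; ring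
      ring_nf
      simp only [hI, hI3]
      linear_combination (S - I*C) * hcs
    rw [e1]
    linear_combination (-z i) * e3
  have hcb : ∀ i ≤ L, ‖c i‖ ≤ 1/(4*θ) := by
    intro i hi
    have hsi := hs i hi
    have hsp : 0 < Real.sin (Real.pi * u i) := by linarith
    have : ‖c i‖^2 = (1/(2*Real.sin (Real.pi * u i)))^2 := by
      have : c i = ((1/2:ℝ):ℂ) + ((κ i/2:ℝ):ℂ)*I := by simp only [hc]; push_cast; ring
      rw [this, Complex.norm_add_mul_I, Real.sq_sqrt (by positivity)]
      simp only [hκ]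
      field_simp
      linear_combination Real.sin_sq_add_cos_sq (Real.pi * u i)
    rw [(sq_eq_sq₀ (norm_nonneg _) (by positivity)).mp this]
    apply one_div_le_one_div_of_le (by positivity); linarith
  have hκb : ∀ i ≤ L, |κ i| ≤ 1/(2*θ) := by
    intro i hi
    have hsi := hs i hi
    have hsp : 0 < Real.sin (Real.pi * u i) := by linarith
    simp only [hκ]
    rw [abs_div, abs_of_pos hsp]
    apply div_le_div₀ (by norm_num) (Real.abs_cos_le_one _) (by positivity) hsi
  have hκm : ∀ i < L, κ i ≤ κ (i+1) := by
    intro i hi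
    have hsi := hs i hi.le
    have hsi' := hs (i+1) hi
    simp only [hκ]
    rw [div_le_div_iff₀ (by linarith) (by linarith)]
    have huu : u (i+1) ≤ u i := by have := hm i hi; simp only [hu]; linarith
    have : 0 ≤ Real.sin (Real.pi * u i - Real.pi * u (i+1)) := by
      apply Real.sin_nonneg_of_nonneg_of_le_pi
      · nlinarith
      · have := hu2 i hi.le; have := hu1 (i+1) hi; nlinarith
    rw [Real.sin_sub] at this
    linarith
  rw [kl_abel c z L hrec]
  have hsum : ‖∑ i ∈ range L, (c (i+1) - c i) * z (i+1)‖ ≤ (κ L - κ 0)/2 := by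
    have : ∀ M ≤ L, ‖∑ i ∈ range M, (c (i+1) - c i) * z (i+1)‖ ≤ (κ M - κ 0)/2 := by
      intro M
      induction M with
      | zero => simp
      | succ M ih =>
        intro hM
        rw [sum_range_succ]
        refine (norm_add_le _ _).trans ?_
        have h1 := ih (by omega)
        have h2 : ‖(c (M+1) - c M) * z (M+1)‖ = (κ (M+1) - κ M)/2 := by
          rw [norm_mul, hz1, mul_one]
          have : c (M+1) - c M = (((κ (M+1) - κ M)/2:ℝ):ℂ) * I := by
            simp only [hc]; push_cast; ring
          rw [this, norm_mul, Complex.norm_I, mul_one, Complex.norm_real, Real.norm_eq_abs, abs_of_nonneg]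
          have := hκm M (by omega); linarith
        rw [h2]; linarith
    exact this L le_rfl
  have a1 := hcb 0 (by omega)
  have a2 := hcb L le_rfl
  have a3 := hκb 0 (by omega)
  have a4 := hκb L le_rfl
  have a5 := (abs_le.mp a3).1
  have a6 := (abs_le.mp a4).2
  calc _ ≤ ‖c 0 * z 0‖ + ‖c L * z (L+1)‖ + ‖∑ i ∈ range L, (c (i+1) - c i) * z (i+1)‖ := by
        refine (norm_add_le _ _).trans ?_
        gcongr
        exact norm_sub_le _ _
    _ ≤ 1/(4*θ) + 1/(4*θ) + (1/(2*θ) + 1/(2*θ))/2 := by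
        rw [norm_mul, norm_mul, hz1, hz1]
        linarith
    _ = 1/θ := by field_simp; norm_num

lemma kl (f : ℕ → ℝ) (A B : ℕ) (k : ℤ) (θ : ℝ) (hθ : 0 < θ)
    (h1 : ∀ i ∈ Ico A B, k + θ ≤ f (i+1) - f i) (h2 : ∀ i ∈ Ico A B, f (i+1) - f i ≤ k + 1 - θ)
    (hm : ∀ i, A ≤ i → i + 1 < B → f (i+2) - f (i+1) ≤ f (i+1) - f i) :
    ‖∑ i ∈ Ico A B, cexp (2*Real.pi*f i*I)‖ ≤ 1/θ := by
  rcases Nat.lt_or_ge A B with h | h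
  · rw [Finset.sum_Ico_eq_sum_range]
    obtain ⟨L, rfl⟩ : ∃ L, B = A + (L+1) := ⟨B - A - 1, by omega⟩
    rw [Nat.add_sub_cancel_left]
    exact kl0 (fun i => f (A+i)) L k θ hθ (fun i hi => h1 (A+i) (by simp; omega)) (fun i hi => h2 (A+i) (by simp; omega))
      (fun i hi => hm (A+i) (by omega) (by omega))
  · rw [Finset.Ico_eq_empty (by omega)]; simp; positivity

lemma filt_Ico (g : ℕ → ℝ) (A B : ℕ) (hm : ∀ i j, A ≤ i → i ≤ j → j < B → g j ≤ g i) (α β : ℝ) :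
    ∃ a b, A ≤ a ∧ b ≤ B ∧ (Ico A B).filter (fun i => α ≤ g i ∧ g i < β) = Ico a b := by
  set S := (Ico A B).filter (fun i => α ≤ g i ∧ g i < β) with hS
  rcases S.eq_empty_or_nonempty with h | h
  · exact ⟨A, 0, le_rfl, by omega, by rw [h]; simp⟩
  · have ha := S.min'_mem h
    have hb := S.max'_mem h
    have ha' := mem_filter.mp ha
    have hb' := mem_filter.mp hb
    rw [mem_Ico] at ha' hb'
    refine ⟨S.min' h, S.max' h + 1, ha'.1.1, hb'.1.2, ?_⟩
    ext n
    constructor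
    · intro hn
      rw [mem_Ico]
      exact ⟨S.min'_le n hn, Nat.lt_succ_of_le (S.le_max' n hn)⟩
    · intro hn
      rw [mem_Ico] at hn
      rw [hS, mem_filter, mem_Ico]
      refine ⟨⟨by omega, by omega⟩, ?_, ?_⟩
      · exact hb'.2.1.trans (hm _ _ (by omega) (by omega) (by omega))
      · exact (hm _ _ ha'.1.1 hn.1 (by omega)).trans_lt ha'.2.2

lemma gap_mono (g : ℕ → ℝ) (A B : ℕ) (lam : ℝ) (hgap : ∀ i, A ≤ i → i + 1 < B → g (i+1) ≤ g i - lam)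
    (i j : ℕ) (hi : A ≤ i) (hij : i ≤ j) (hj : j < B) : g j ≤ g i - lam * (j - i : ℕ) := by
  induction j, hij using Nat.le_induction with
  | base => simp
  | succ j hij ih =>
    have := ih (by omega)
    have h2 := hgap j (by omega) hj
    rw [Nat.succ_sub hij]; push_cast
    linarith

/-- van der Corput second derivative test, discrete form -/
lemma vdc (f : ℕ → ℝ) (A B : ℕ) (lam R θ : ℝ) (hl : 0 < lam) (hR : 0 ≤ R) (hθ : 0 < θ)
    (hgap : ∀ i, A ≤ i → i + 1 < B → f (i+2) - f (i+1) ≤ f (i+1) - f i - lam)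
    (h0 : ∀ i ∈ Ico A B, 0 ≤ f (i+1) - f i) (h1 : ∀ i ∈ Ico A B, f (i+1) - f i ≤ R) :
    ‖∑ i ∈ Ico A B, cexp (2*Real.pi*f i*I)‖ ≤ (R + θ + 1) * (2*θ/lam + 1 + 1/θ) := by
  set g : ℕ → ℝ := fun i => f (i+1) - f i with hg
  set z : ℕ → ℂ := fun i => cexp (2*Real.pi*f i*I) with hz
  have hz1 : ∀ i, ‖z i‖ = 1 := fun i => by
    simp only [hz]
    rw [show (2*Real.pi*f i*I:ℂ) = ((2*Real.pi*f i:ℝ):ℂ)*I by push_cast; ring, Complex.norm_exp_ofReal_mul_I]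
  have hgm := gap_mono g A B lam hgap
  have hgm' : ∀ i j, A ≤ i → i ≤ j → j < B → g j ≤ g i := by
    intro i j hi hij hj
    have := hgm i j hi hij hj
    have : 0 ≤ lam * (j - i : ℕ) := by positivity
    linarith
  have hmaps : ∀ i ∈ Ico A B, ⌊g i + θ⌋₊ ∈ range (⌊R + θ⌋₊ + 1) := by
    intro i hi
    rw [mem_range, Nat.lt_succ_iff]
    apply Nat.floor_le_floor
    have := h1 i hi
    simp only [hg]; linarith
  rw [← Finset.sum_fiberwise_of_maps_to hmaps]
  have hfib : ∀ k ∈ range (⌊R + θ⌋₊ + 1), ‖∑ i ∈ (Ico A B).filter (fun i => ⌊g i + θ⌋₊ = k), z i‖ ≤ 2*θ/lam + 1 + 1/θ := by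
    intro k _
    have hfl : ∀ i ∈ Ico A B, (⌊g i + θ⌋₊ = k ↔ (k - θ ≤ g i ∧ g i < k + 1 - θ)) := by
      intro i hi
      have := h0 i hi
      have hg0 : 0 ≤ g i := this
      rw [Nat.floor_eq_iff (by linarith)]
      constructor <;> rintro ⟨a, b⟩ <;> constructor <;> linarith
    have hsplit : (Ico A B).filter (fun i => ⌊g i + θ⌋₊ = k) ⊆ (Ico A B).filter (fun i => k - θ ≤ g i ∧ g i < k + θ) ∪ (Ico A B).filter (fun i => k + θ ≤ g i ∧ g i < k + 1 - θ) := by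
      intro i hi
      rw [mem_filter] at hi
      have := (hfl i hi.1).mp hi.2
      rw [mem_union, mem_filter, mem_filter]
      rcases lt_or_ge (g i) (k+θ) with h | h
      · left; exact ⟨hi.1, this.1, h⟩
      · right; exact ⟨hi.1, h, this.2⟩
    have hsub2 : (Ico A B).filter (fun i => k + θ ≤ g i ∧ g i < k + 1 - θ) ⊆ (Ico A B).filter (fun i => ⌊g i + θ⌋₊ = k) := by
      intro i hi
      rw [mem_filter] at hi ⊢
      exact ⟨hi.1, (hfl i hi.1).mpr ⟨by linarith [hi.2.1], hi.2.2⟩⟩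
    rw [← Finset.sum_sdiff hsub2]
    refine (norm_add_le _ _).trans (add_le_add ?_ ?_)
    · refine (norm_sum_le _ _).trans ?_
      simp only [hz1, sum_const, nsmul_eq_mul, mul_one]
      obtain ⟨a, b, ha, hb, hab⟩ := filt_Ico g A B hgm' (k-θ) (k+θ)
      have hss : (Ico A B).filter (fun i => ⌊g i + θ⌋₊ = k) \ (Ico A B).filter (fun i => k + θ ≤ g i ∧ g i < k + 1 - θ) ⊆ Ico a b := by
        rw [← hab]
        intro i hi
        rw [mem_sdiff] at hi
        have := hsplit hi.1
        rw [mem_union] at this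
        tauto
      have hc : ((Finset.card ((Ico A B).filter (fun i => ⌊g i + θ⌋₊ = k) \ (Ico A B).filter (fun i => k + θ ≤ g i ∧ g i < k + 1 - θ)) : ℕ) : ℝ) ≤ ((b - a : ℕ) : ℝ) := by
        have := Finset.card_le_card hss
        rw [Nat.card_Ico] at this
        exact_mod_cast this
      refine hc.trans ?_
      rcases Nat.lt_or_ge a b with h | h
      · have ma : a ∈ Ico a b := by simp [h]
        have mb : b - 1 ∈ Ico a b := by simp; omega
        rw [← hab, mem_filter] at ma mb
        have h3 := hgm a (b-1) ha (by omega) (by omega)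
        have h4 : lam * ((b - 1 - a : ℕ):ℝ) ≤ 2*θ := by linarith [ma.2.2, mb.2.1]
        have h5 : ((b - a : ℕ):ℝ) = ((b-1-a:ℕ):ℝ) + 1 := by
          rw [show b - a = (b-1-a)+1 by omega]; push_cast; rfl
        rw [h5]
        have : ((b - 1 - a : ℕ):ℝ) ≤ 2*θ/lam := by rw [le_div_iff₀ hl]; linarith
        linarith
      · rw [Nat.sub_eq_zero_of_le h]; simp; positivity
    · obtain ⟨a, b, ha, hb, hab⟩ := filt_Ico g A B hgm' (k+θ) (k+1-θ)
      rw [hab]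
      apply kl f a b (k:ℤ) θ hθ
      · intro i hi; rw [← hab, mem_filter] at hi; exact_mod_cast hi.2.1
      · intro i hi; rw [← hab, mem_filter] at hi; push_cast; exact hi.2.2.le
      · intro i hi hi2
        have := hgap i (by omega) (by omega)
        linarith
  refine (norm_sum_le _ _).trans ((Finset.sum_le_sum hfib).trans ?_)
  rw [sum_const, card_range, nsmul_eq_mul]
  have : ((⌊R + θ⌋₊ + 1 : ℕ):ℝ) ≤ R + θ + 1 := by
    push_cast
    have := Nat.floor_le (by linarith : 0 ≤ R + θ)
    linarith
  gcongr


lemma abel_mono (w : ℕ → ℝ) (z : ℕ → ℂ) (K : ℝ) (L : ℕ) (hw : ∀ i, 0 ≤ w i) (hm : ∀ i, w (i+1) ≤ w i)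
    (hK : ∀ i ≤ L, ‖∑ j ∈ range i, z j‖ ≤ K) : ‖∑ i ∈ range L, (w i : ℂ) * z i‖ ≤ K * w 0 := by
  have key : ∀ M, ∑ i ∈ range M, (w i : ℂ) * z i = w M * ∑ j ∈ range M, z j + ∑ i ∈ range M, ((w i - w (i+1) : ℝ) : ℂ) * ∑ j ∈ range (i+1), z j := by
    intro M
    induction M with
    | zero => simp
    | succ M ih => rw [sum_range_succ, ih, sum_range_succ (fun i => ((w i - w (i+1) : ℝ) : ℂ) * _), sum_range_succ z]; push_cast; ring
  have hb : ∀ M ≤ L, ‖∑ i ∈ range M, ((w i - w (i+1) : ℝ) : ℂ) * ∑ j ∈ range (i+1), z j‖ ≤ K * (w 0 - w M) := by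
    intro M
    induction M with
    | zero => simp
    | succ M ih =>
      intro hM
      rw [sum_range_succ]
      refine (norm_add_le _ _).trans ?_
      have h1 := ih (by omega)
      have h2 := hK (M+1) hM
      rw [norm_mul, Complex.norm_real, Real.norm_eq_abs, abs_of_nonneg (by linarith [hm M])]
      have := mul_le_mul_of_nonneg_left h2 (by linarith [hm M] : 0 ≤ w M - w (M+1))
      nlinarith
  rw [key]
  refine (norm_add_le _ _).trans ?_
  rw [norm_mul, Complex.norm_real, Real.norm_eq_abs, abs_of_nonneg (hw L)]
  have := mul_le_mul_of_nonneg_left (hK L le_rfl) (hw L)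
  have := hb L le_rfl
  linarith

lemma blk_pos (t x : ℝ) (ht : 1 ≤ t) (hx0 : 0 < x) (hx1 : x ≤ 1) (M B : ℕ) (hM : 1 ≤ M) (hB : B ≤ 2*M)
    (hM1 : Real.sqrt t ≤ M) (hM2 : (M:ℝ) ≤ 2 * (1+t)^(3/2:ℝ)) :
    ‖∑ n ∈ Ico M B, cexp (t * Real.log (n+x) * I)‖ ≤ 100 * Real.sqrt (1+t) := by
  have hpi := Real.pi_pos
  have hpi3 := Real.pi_gt_three
  have hpi4 := Real.pi_lt_d2
  have hM' : (1:ℝ) ≤ M := by exact_mod_cast hM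
  set f : ℕ → ℝ := fun n => t/(2*Real.pi) * Real.log (n+x) with hf
  have e : ∀ n ∈ Ico M B, cexp (t * Real.log (n+x) * I) = cexp (2*Real.pi*f n*I) := by
    intro n _
    congr 1
    simp only [hf]; push_cast
    field_simp
  rw [sum_congr rfl e]
  have hdiff : ∀ n : ℕ, f (n+1) - f n = t/(2*Real.pi) * Real.log ((n+1+x)/(n+x)) := by
    intro n
    rw [Real.log_div (by positivity) (by positivity)]
    simp only [hf]; push_cast; ring
  have hlow : ∀ n ∈ Ico M B, t/(20*M) ≤ f (n+1) - f n := by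
    intro n hn
    rw [mem_Ico] at hn
    have hn' : (n:ℝ) + 1 ≤ 2*M := by exact_mod_cast (by omega : n+1 ≤ 2*M)
    rw [hdiff]
    have h1 := Real.one_sub_inv_le_log_of_pos (show (0:ℝ) < (n+1+x)/(n+x) by positivity)
    have h2 : 1 - ((n+1+x)/(n+x))⁻¹ = 1/(n+1+x) := by field_simp; ring
    rw [h2] at h1
    have h3 : 1/(3*M:ℝ) ≤ 1/((n:ℝ)+1+x) := one_div_le_one_div_of_le (by positivity) (by linarith)
    calc t/(20*M) ≤ t/(2*Real.pi) * (1/(3*M)) := by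
          rw [div_mul_div_comm, mul_one]
          apply div_le_div_of_nonneg_left (by linarith) (by positivity)
          nlinarith
      _ ≤ _ := by gcongr; linarith
  have hup : ∀ n ∈ Ico M B, f (n+1) - f n ≤ t/(6*M) := by
    intro n hn
    rw [mem_Ico] at hn
    have hn' : (M:ℝ) ≤ n := by exact_mod_cast hn.1
    rw [hdiff]
    have h1 := Real.log_le_sub_one_of_pos (show (0:ℝ) < (n+1+x)/(n+x) by positivity)
    have h2 : (n+1+x)/(n+x) - 1 = 1/(n+x) := by field_simp; ring
    rw [h2] at h1
    have h3 : 1/((n:ℝ)+x) ≤ 1/(M:ℝ) := one_div_le_one_div_of_le (by positivity) (by linarith)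
    calc _ ≤ t/(2*Real.pi) * (1/M) := by gcongr; linarith
      _ ≤ _ := by 
          rw [div_mul_div_comm, mul_one]
          apply div_le_div_of_nonneg_left (by linarith) (by positivity)
          nlinarith
  have hgap : ∀ i, M ≤ i → i + 1 < B → f (i+2) - f (i+1) ≤ f (i+1) - f i - t/(64*M^2) := by
    intro n hn hn2
    have hn' : (n:ℝ) + 2 ≤ 2*M := by exact_mod_cast (by omega : n+2 ≤ 2*M)
    rw [show n + 2 = (n+1)+1 by ring, hdiff, hdiff]
    have e1 : Real.log ((n+1+x)/(n+x)) - Real.log (((n+1:ℕ)+1+x)/((n+1:ℕ)+x)) = Real.log ((n+1+x)^2/((n+x)*(n+2+x))) := by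
      rw [← Real.log_div (by positivity) (by positivity)]
      congr 1
      push_cast
      field_simp
      ring
    have h1 := Real.one_sub_inv_le_log_of_pos (show (0:ℝ) < (n+1+x)^2/((n+x)*(n+2+x)) by positivity)
    have h2 : 1 - ((n+1+x)^2/((n+x)*(n+2+x)))⁻¹ = 1/(n+1+x)^2 := by field_simp; ring
    rw [h2] at h1
    have h3 : 1/(2*M:ℝ)^2 ≤ 1/((n:ℝ)+1+x)^2 := by
      apply one_div_le_one_div_of_le (by positivity)
      apply pow_le_pow_left₀ (by positivity); linarith
    have h4 : t/(64*M^2) ≤ t/(2*Real.pi) * (1/(2*M)^2) := by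
      rw [div_mul_div_comm, mul_one]
      apply div_le_div_of_nonneg_left (by linarith) (by positivity)
      nlinarith [sq_nonneg (M:ℝ)]
    have h5 : t/(2*Real.pi) * (1/(2*M)^2) ≤ t/(2*Real.pi) * (Real.log ((n+1+x)/(n+x)) - Real.log (((n+1:ℕ)+1+x)/((n+1:ℕ)+x))) := by
      rw [e1]; gcongr; linarith
    rw [mul_sub] at h5
    linarith
  have hst : 1 ≤ Real.sqrt t := Real.one_le_sqrt.mpr ht
  have hst2 : Real.sqrt t * Real.sqrt t = t := Real.mul_self_sqrt (by linarith)
  have hTt : Real.sqrt t ≤ Real.sqrt (1+t) := Real.sqrt_le_sqrt (by linarith)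
  rcases le_total (M:ℝ) t with hc | hc
  · have h := vdc f M B (t/(64*M^2)) (t/(6*M)) (Real.sqrt t/(8*M)) (by positivity) (by positivity) (by positivity) hgap
      (fun i hi => le_trans (by positivity) (hlow i hi)) hup
    refine h.trans ?_
    have h1 : 2*(Real.sqrt t/(8*M))/(t/(64*M^2)) = 16*M/Real.sqrt t := by
      nth_rewrite 2 [← hst2]; field_simp; ring
    have h2 : 1/(Real.sqrt t/(8*M)) = 8*M/Real.sqrt t := by field_simp
    have h3 : 1 ≤ M/Real.sqrt t := by rw [le_div_iff₀ (by positivity)]; linarith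
    have h4 : Real.sqrt t/(8*M) ≤ 1 := by rw [div_le_iff₀ (by positivity)]; linarith
    have h5 : 1 ≤ t/M := by rw [le_div_iff₀ (by positivity)]; linarith
    have h6 : t/(6*M) = t/M/6 := by field_simp
    rw [h1, h2, h6]
    calc _ ≤ (3*(t/M)) * (25*(M/Real.sqrt t)) := by
          apply mul_le_mul
          · linarith
          · rw [mul_div_assoc, mul_div_assoc]; linarith
          · positivity
          · positivity
      _ = 75 * Real.sqrt t := by
          nth_rewrite 1 [← hst2]; field_simp; norm_num
      _ ≤ _ := by nlinarith
  · have h := kl f M B 0 (t/(20*M)) (by positivity) (fun i hi => by simpa using hlow i hi)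
      (fun i hi => by
        have h1 := hup i hi
        have h2 : t/M ≤ 1 := by rw [div_le_iff₀ (by positivity)]; linarith
        have h3 : t/(6*M) = t/M/6 := by field_simp
        have h4 : t/(20*M) = t/M/20 := by field_simp
        rw [h4]; rw [h3] at h1; push_cast; linarith)
      (fun i hi hi2 => by
        have h1 := hgap i hi hi2
        have : 0 ≤ t/(64*M^2) := by positivity
        linarith)
    refine h.trans ?_
    have e1 : (1+t)^(3/2:ℝ) = (1+t) * Real.sqrt (1+t) := by
      rw [Real.sqrt_eq_rpow, show (3/2:ℝ) = 1 + 1/2 by norm_num, Real.rpow_add (by positivity), Real.rpow_one]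
    rw [e1] at hM2
    rw [one_div_div, div_le_iff₀ (by positivity)]
    have hs := Real.sqrt_nonneg (1+t)
    nlinarith [mul_nonneg hs (by linarith : 0 ≤ t - 1)]

lemma blk_un (t x : ℝ) (hx0 : 0 < x) (hx1 : x ≤ 1) (M B : ℕ) (hM : 1 ≤ M) (hB : B ≤ 2*M)
    (hM2 : (M:ℝ) ≤ 2 * (1+|t|)^(3/2:ℝ)) :
    ‖∑ n ∈ Ico M B, cexp (-(t * Real.log (n+x) * I))‖ ≤ 100 * min (M:ℝ) (Real.sqrt (1+|t|)) := by
  have hM' : (1:ℝ) ≤ M := by exact_mod_cast hM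
  have hs1 : 1 ≤ Real.sqrt (1+|t|) := Real.one_le_sqrt.mpr (by linarith [abs_nonneg t])
  have triv : ‖∑ n ∈ Ico M B, cexp (-(t * Real.log (n+x) * I))‖ ≤ M := by
    refine (norm_sum_le _ _).trans ?_
    have : ∀ n ∈ Ico M B, ‖cexp (-(t * Real.log (n+x) * I))‖ = 1 := by
      intro n _
      rw [show (-(t * Real.log (n+x) * I):ℂ) = ((-(t*Real.log (n+x)):ℝ):ℂ) * I by push_cast; ring, Complex.norm_exp_ofReal_mul_I]
    rw [sum_congr rfl this, sum_const, Nat.card_Ico, nsmul_eq_mul, mul_one]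
    exact_mod_cast (by omega : B - M ≤ M)
  rw [mul_min_of_nonneg _ _ (by norm_num)]
  apply le_min
  · linarith
  rcases le_total (M:ℝ) (Real.sqrt (1+|t|)) with h1 | h1
  · linarith
  rcases lt_or_ge |t| 1 with h2 | h2
  · have : (1+|t|)^(3/2:ℝ) ≤ 2^(3/2:ℝ) := Real.rpow_le_rpow (by positivity) (by linarith) (by norm_num)
    have : (2:ℝ)^(3/2:ℝ) ≤ 2^(2:ℝ) := Real.rpow_le_rpow_of_exponent_le (by norm_num) (by norm_num)
    norm_num at this
    linarith
  have hb := blk_pos |t| x h2 hx0 hx1 M B hM hB ((Real.sqrt_le_sqrt (by linarith)).trans h1) hM2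
  rcases le_total 0 t with h3 | h3
  · rw [abs_of_nonneg h3] at hb ⊢
    refine le_trans (le_of_eq ?_) hb
    rw [← Complex.norm_conj, map_sum]
    congr 1
    apply sum_congr rfl
    intro n _
    rw [← Complex.exp_conj]
    congr 1
    simp
  · rw [abs_of_nonpos h3] at hb ⊢
    refine le_trans (le_of_eq ?_) hb
    congr 1
    apply sum_congr rfl
    intro n _
    congr 1
    push_cast; ring

lemma blk (σ t x : ℝ) (hσ : 0 ≤ σ) (hx0 : 0 < x) (hx1 : x ≤ 1) (M : ℕ) (hM : 1 ≤ M)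
    (hM2 : (M:ℝ) ≤ 2 * (1+|t|)^(3/2:ℝ)) :
    ‖∑ n ∈ Ico M (2*M), 1 / ((n:ℂ)+x)^((σ:ℂ)+t*I)‖ ≤ 100 * (min (M:ℝ) (Real.sqrt (1+|t|)) * (M:ℝ)^(-σ)) := by
  have hM' : (1:ℝ) ≤ M := by exact_mod_cast hM
  rw [Finset.sum_Ico_eq_sum_range, show 2*M - M = M by omega]
  have e : ∀ i ∈ range M, 1 / (((M+i:ℕ):ℂ)+x)^((σ:ℂ)+t*I) = ((((M+i:ℕ):ℝ)+x)^(-σ) : ℝ) * cexp (-(t * Real.log ((M+i:ℕ)+x) * I)) := by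
    intro i _
    have hp : (0:ℝ) < ((M+i:ℕ):ℝ)+x := by positivity
    rw [show (((M+i:ℕ):ℂ)+x) = ((((M+i:ℕ):ℝ)+x : ℝ):ℂ) by push_cast; rfl, Complex.cpow_def_of_ne_zero (by exact_mod_cast hp.ne'), ← Complex.ofReal_log hp.le, one_div, ← Complex.exp_neg, Real.rpow_def_of_pos hp, Complex.ofReal_exp, ← Complex.exp_add]
    congr 1
    push_cast; ring
  rw [sum_congr rfl e]
  have := abel_mono (fun i => (((M+i:ℕ):ℝ)+x)^(-σ)) (fun i => cexp (-(t * Real.log ((M+i:ℕ)+x) * I))) (100 * min (M:ℝ) (Real.sqrt (1+|t|))) M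
    (fun i => by positivity)
    (fun i => by
      apply Real.rpow_le_rpow_of_nonpos (by positivity) _ (by linarith)
      push_cast; linarith)
    (fun i hi => by
      have := blk_un t x hx0 hx1 M (M+i) hM (by omega) hM2
      rw [Finset.sum_Ico_eq_sum_range, Nat.add_sub_cancel_left] at this
      exact this)
  refine this.trans ?_
  rw [mul_assoc]
  have : (((M+0:ℕ):ℝ)+x)^(-σ) ≤ (M:ℝ)^(-σ) := by
    apply Real.rpow_le_rpow_of_nonpos (by positivity) _ (by linarith)
    push_cast; linarith
  gcongr


lemma dy_sum (σ : ℝ) (h0 : 0 < σ) (h1 : σ < 1) : ∃ C : ℝ, 0 ≤ C ∧ ∀ Y : ℝ, 1 ≤ Y → ∀ J : ℕ,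
    ∑ j ∈ range J, min (((2^j : ℕ)):ℝ) Y * (((2^j : ℕ)):ℝ)^(-σ) ≤ C * Y^(1-σ) := by
  set r : ℝ := 2^(1-σ) with hr
  set q : ℝ := 2^(-σ) with hq
  have hr1 : 1 < r := Real.one_lt_rpow (by norm_num) (by linarith)
  have hq0 : 0 < q := by positivity
  have hq1 : q < 1 := Real.rpow_lt_one_of_one_lt_of_neg (by norm_num) (by linarith)
  have er : ∀ j : ℕ, (((2^j : ℕ)):ℝ)^(1-σ) = r^j := by
    intro j; push_cast; rw [hr, ← Real.rpow_natCast, ← Real.rpow_natCast, ← Real.rpow_mul (by norm_num), ← Real.rpow_mul (by norm_num), mul_comm]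
  have eq : ∀ j : ℕ, (((2^j : ℕ)):ℝ)^(-σ) = q^j := by
    intro j; push_cast; rw [hq, ← Real.rpow_natCast, ← Real.rpow_natCast, ← Real.rpow_mul (by norm_num), ← Real.rpow_mul (by norm_num), mul_comm]
  refine ⟨r/(r-1) + 1/(1-q), by
    have : 0 < r - 1 := by linarith
    have : 0 < 1 - q := by linarith
    positivity, fun Y hY J => ?_⟩
  have hr2 : 0 < r - 1 := by linarith
  have hq2 : 0 < 1 - q := by linarith
  obtain ⟨K, hK1, hK2⟩ := exists_nat_pow_near hY (by norm_num : (1:ℝ) < 2)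
  have hsub : ∑ j ∈ range J, min (((2^j : ℕ)):ℝ) Y * (((2^j : ℕ)):ℝ)^(-σ) ≤ ∑ j ∈ range (K+1+J), min (((2^j : ℕ)):ℝ) Y * (((2^j : ℕ)):ℝ)^(-σ) := by
    apply sum_le_sum_of_subset_of_nonneg
    · intro i; simp only [mem_range]; omega
    · intro i _ _; positivity
  refine hsub.trans ?_
  rw [sum_range_add, add_mul]
  apply add_le_add
  · calc _ ≤ ∑ j ∈ range (K+1), r^j := by
          apply sum_le_sum
          intro j _
          rw [← er]
          have : (0:ℝ) < ((2^j:ℕ):ℝ) := by positivity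
          rw [sub_eq_add_neg, Real.rpow_add this, Real.rpow_one]
          gcongr
          exact min_le_left _ _
      _ = (r^(K+1)-1)/(r-1) := geom_sum_eq hr1.ne' _
      _ ≤ r * Y^(1-σ) / (r-1) := by
          gcongr
          have : r^K ≤ Y^(1-σ) := by
            rw [← er]; apply Real.rpow_le_rpow (by positivity) _ (by linarith)
            push_cast; exact hK1
          rw [pow_succ]; nlinarith
      _ = _ := by ring
  · calc _ ≤ ∑ j ∈ range J, Y * q^(K+1) * q^j := by
          apply sum_le_sum
          intro j _
          rw [eq, pow_add q, mul_assoc]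
          gcongr
          exact min_le_right _ _
      _ = Y * q^(K+1) * ∑ j ∈ range J, q^j := by rw [mul_sum]
      _ ≤ Y * Y^(-σ) * (1/(1-q)) := by
          have a1 : q^(K+1) ≤ Y^(-σ) := by
            rw [← eq]
            apply Real.rpow_le_rpow_of_nonpos (by linarith) _ (by linarith)
            push_cast; exact hK2.le
          have a2 : ∑ j ∈ range J, q^j ≤ 1/(1-q) := by
            rw [one_div, ← tsum_geometric_of_lt_one hq0.le hq1]
            exact (summable_geometric_of_lt_one hq0.le hq1).sum_le_tsum _ (fun i _ => by positivity)
          have : 0 ≤ ∑ j ∈ range J, q^j := sum_nonneg (fun i _ => by positivity)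
          gcongr
      _ = _ := by
          rw [show (1-σ) = 1 + -σ by ring, Real.rpow_add (by linarith), Real.rpow_one]; ring

lemma dy_split (h : ℕ → ℂ) (J : ℕ) : ∑ n ∈ Ico 1 (2^J), h n = ∑ j ∈ range J, ∑ n ∈ Ico (2^j) (2*2^j), h n := by
  induction J with
  | zero => simp
  | succ J ih =>
    rw [sum_range_succ, ← ih, pow_succ, mul_comm (2^J) 2, Finset.sum_Ico_consecutive]
    · exact Nat.one_le_two_pow
    · omega

lemma head_bd (σ : ℝ) (h0 : 0 < σ) (h1 : σ < 1) : ∃ C : ℝ, 0 ≤ C ∧ ∀ t x : ℝ, 0 < x → x ≤ 1 → ∀ J : ℕ,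
    ((2^J:ℕ):ℝ) ≤ 2 * (1+|t|)^(3/2:ℝ) → ‖∑ n ∈ Ico (1:ℕ) (2^J), 1 / ((n:ℂ)+x)^((σ:ℂ)+t*I)‖ ≤ C * (1+|t|)^((1-σ)/2) := by
  obtain ⟨C, hC0, hC⟩ := dy_sum σ h0 h1
  refine ⟨100*C, by positivity, fun t x hx0 hx1 J hJ => ?_⟩
  rw [dy_split]
  have hs1 : 1 ≤ Real.sqrt (1+|t|) := Real.one_le_sqrt.mpr (by linarith [abs_nonneg t])
  have := hC _ hs1 J
  calc _ ≤ ∑ j ∈ range J, 100 * (min (((2^j : ℕ)):ℝ) (Real.sqrt (1+|t|)) * (((2^j : ℕ)):ℝ)^(-σ)) := by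
        refine (norm_sum_le _ _).trans (sum_le_sum ?_)
        intro j hj
        rw [mem_range] at hj
        apply blk σ t x h0.le hx0 hx1 (2^j) Nat.one_le_two_pow
        refine le_trans ?_ hJ
        exact_mod_cast Nat.pow_le_pow_right (by norm_num) hj.le
    _ ≤ 100 * (C * (Real.sqrt (1+|t|))^(1-σ)) := by rw [← mul_sum]; gcongr
    _ = _ := by
        rw [Real.sqrt_eq_rpow, ← Real.rpow_mul (by positivity), mul_assoc]; congr 3; ring

lemma midpt (G0 G1 G2 G3 : ℝ → ℂ) (y K : ℝ) (hy : 1/2 < y)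
    (d0 : ∀ v, 0 < v → HasDerivAt G0 (G1 v) v) (d1 : ∀ v, 0 < v → HasDerivAt G1 (G2 v) v)
    (d2 : ∀ v, 0 < v → HasDerivAt G2 (G3 v) v) (hK : ∀ v, y - 1/2 ≤ v → ‖G3 v‖ ≤ K) :
    ‖G1 y - (G0 (y+1/2) - G0 (y-1/2))‖ ≤ 2*K := by
  have hK0 : 0 ≤ K := (norm_nonneg _).trans (hK (y-1/2) le_rfl)
  have hp : ∀ (G G' : ℝ → ℂ), (∀ v, 0 < v → HasDerivAt G (G' v) v) → ∀ h ∈ Set.Icc (0:ℝ) (1/2), HasDerivAt (fun h => G (y+h)) (G' (y+h)) h := by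
    intro G G' hG h hh
    exact HasDerivAt.comp_const_add y h (hG (y+h) (by linarith [hh.1]))
  have hn : ∀ (G G' : ℝ → ℂ), (∀ v, 0 < v → HasDerivAt G (G' v) v) → ∀ h ∈ Set.Icc (0:ℝ) (1/2), HasDerivAt (fun h => G (y-h)) (-G' (y-h)) h := by
    intro G G' hG h hh
    exact HasDerivAt.comp_const_sub y h (hG (y-h) (by linarith [hh.2]))
  have step : ∀ (F F' : ℝ → ℂ), F 0 = 0 → (∀ h ∈ Set.Icc (0:ℝ) (1/2), HasDerivAt F (F' h) h) → (∀ h ∈ Set.Icc (0:ℝ) (1/2), ‖F' h‖ ≤ 2*K) → ∀ h ∈ Set.Icc (0:ℝ) (1/2), ‖F h‖ ≤ 2*K := by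
    intro F F' hF0 hd hb h hh
    have := norm_image_sub_le_of_norm_deriv_le_segment' (f := F) (f' := F') (a := 0) (b := 1/2) (C := 2*K) (fun x hx => (hd x hx).hasDerivWithinAt)
      (fun x hx => hb x ⟨hx.1, hx.2.le⟩) h hh
    rw [hF0, sub_zero, sub_zero] at this
    refine this.trans ?_
    nlinarith [hh.1, hh.2]
  have s2 := step (fun h => -(G2 (y+h)) + G2 (y-h)) (fun h => -(G3 (y+h)) + -G3 (y-h)) (by simp)
    (fun h hh => (hp G2 G3 d2 h hh).neg.add (hn G2 G3 d2 h hh))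
    (fun h hh => by
      refine (norm_add_le _ _).trans ?_
      rw [norm_neg, norm_neg]
      linarith [hK (y+h) (by linarith [hh.1]), hK (y-h) (by linarith [hh.2])])
  have s1 := step (fun h => 2 * G1 y - G1 (y+h) - G1 (y-h)) (fun h => -(G2 (y+h)) + G2 (y-h)) (by simp; ring)
    (fun h hh => by
      have := ((hp G1 G2 d1 h hh).const_sub (2*G1 y)).sub (hn G1 G2 d1 h hh)
      exact this.congr_deriv (by ring)) s2
  have s0 := step (fun h => ((2*h:ℝ):ℂ) * G1 y - (G0 (y+h) - G0 (y-h))) (fun h => 2 * G1 y - G1 (y+h) - G1 (y-h)) (by simp)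
    (fun h hh => by
      have a : HasDerivAt (fun h : ℝ => ((2*h:ℝ):ℂ) * G1 y) (2 * G1 y) h := by
        have : HasDerivAt (fun h : ℝ => 2*h) 2 h := by simpa using (hasDerivAt_id h).const_mul (2:ℝ)
        simpa using this.ofReal_comp.mul_const (G1 y)
      have := a.sub ((hp G0 G1 d0 h hh).sub (hn G0 G1 d0 h hh))
      refine this.congr_deriv ?_
      ring) s1
  have := s0 (1/2) (by constructor <;> norm_num)
  simpa using this

/-- the Euler–Maclaurin (midpoint) term -/
noncomputable def emTerm (x : ℝ) (n : ℕ) (s : ℂ) : ℂ :=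
  1/((n:ℂ)+x)^s - (((n:ℂ)+x+1/2)^(1-s)/(1-s) - ((n:ℂ)+x-1/2)^(1-s)/(1-s))

lemma emTerm_bd (x : ℝ) (hx0 : 0 < x) (n : ℕ) (hn : 1 ≤ n) (s : ℂ) (hs : 0 < s.re) (hs1 : s ≠ 1) :
    ‖emTerm x n s‖ ≤ 2 * (‖s‖ * ‖s+1‖ * ((n:ℝ)/2)^(-s.re-2)) := by
  have hn' : (1:ℝ) ≤ n := by exact_mod_cast hn
  have hs0 : s ≠ 0 := by intro h; rw [h] at hs; simp at hs
  have hsm : -s ≠ -1 := by intro h; apply hs1; linear_combination -h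
  have hs11 : -s-1 ≠ 0 := by
    intro h
    have := congrArg Complex.re h; simp at this; linarith
  have := midpt (fun v => (v:ℂ)^(1-s)/(1-s)) (fun v => (v:ℂ)^(-s)) (fun v => (-s) * (v:ℂ)^(-s-1)) (fun v => (-s) * ((-s-1)*(v:ℂ)^(-s-1-1)))
    (n+x) (‖s‖ * ‖s+1‖ * ((n:ℝ)/2)^(-s.re-2)) (by linarith)
    (fun v hv => by
      have := hasDerivAt_ofReal_cpow_const' hv.ne' hsm
      rwa [show -s + 1 = 1 - s by ring] at this)
    (fun v hv => hasDerivAt_ofReal_cpow_const hv.ne' (neg_ne_zero.mpr hs0))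
    (fun v hv => (hasDerivAt_ofReal_cpow_const hv.ne' hs11).const_mul (-s))
    (fun v hv => by
      have hv0 : 0 < v := by linarith
      rw [norm_mul, norm_mul, norm_neg, show -s-1 = -(s+1) by ring, norm_neg, Complex.norm_cpow_eq_rpow_re_of_pos hv0, ← mul_assoc]
      have : (-(s+1)-1).re = -s.re-2 := by simp; ring
      rw [this]
      apply mul_le_mul_of_nonneg_left _ (by positivity)
      exact Real.rpow_le_rpow_of_nonpos (by positivity) (by linarith) (by linarith))
  refine le_trans (le_of_eq ?_) this
  unfold emTerm
  congr 1
  rw [Complex.cpow_neg]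
  push_cast
  simp only [one_div]


lemma preconn_U : IsPreconnected {s : ℂ | 0 < s.re ∧ s ≠ 1} := by
  have hA : Convex ℝ {s : ℂ | 0 < s.re ∧ 0 < s.im} := (convex_halfSpace_re_gt 0).inter (convex_halfSpace_im_gt 0)
  have hB : Convex ℝ {s : ℂ | 1 < s.re} := convex_halfSpace_re_gt 1
  have hC : Convex ℝ {s : ℂ | 0 < s.re ∧ s.im < 0} := (convex_halfSpace_re_gt 0).inter (convex_halfSpace_im_lt 0)
  have hD : Convex ℝ {s : ℂ | 0 < s.re ∧ s.re < 1} := (convex_halfSpace_re_gt 0).inter (convex_halfSpace_re_lt 1)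
  have h1 := IsPreconnected.union (2+I) (by simp) (by simp) hA.isPreconnected hB.isPreconnected
  have h2 := IsPreconnected.union (2-I) (by right; simp) (by simp) h1 hC.isPreconnected
  have h3 := IsPreconnected.union (1/2+I) (by left; left; simp) (by constructor <;> norm_num [Complex.add_re]) h2 hD.isPreconnected
  convert h3 using 1
  ext s
  simp only [Set.mem_ofPred_eq, Set.mem_union]
  constructor
  · rintro ⟨h, hs⟩
    rcases lt_trichotomy s.im 0 with h' | h' | h'
    · tauto
    · rcases lt_trichotomy s.re 1 with h'' | h'' | h''
      · tauto
      · exact absurd (Complex.ext (by simpa using h'') (by simpa using h')) hs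
      · tauto
    · tauto
  · rintro (((h | h) | h) | h)
    · exact ⟨h.1, fun hs => by rw [hs] at h; simp at h⟩
    · exact ⟨by linarith, fun hs => by rw [hs] at h; simp at h⟩
    · exact ⟨h.1, fun hs => by rw [hs] at h; simp at h⟩
    · exact ⟨h.1, fun hs => by rw [hs] at h; simp at h⟩

lemma summ_sq (N : ℕ) : Summable (fun n : ℕ => 1 / ((N+n:ℕ):ℝ)^2) := by
  have := (Real.summable_one_div_nat_pow (p := 2)).mpr (by norm_num)
  have := (summable_nat_add_iff N).mpr this
  simpa [add_comm] using this

/-- locally uniform bound -/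
lemma emTerm_loc (x : ℝ) (hx0 : 0 < x) (n : ℕ) (hn : 1 ≤ n) (R : ℝ) (s : ℂ) (hs : 0 < s.re) (hs1 : s ≠ 1) (hR : ‖s‖ ≤ R) :
    ‖emTerm x n s‖ ≤ 2 * (R * (R+1) * 2^(R+2)) * (1/(n:ℝ)^2) := by
  refine (emTerm_bd x hx0 n hn s hs hs1).trans ?_
  have hn' : (1:ℝ) ≤ n := by exact_mod_cast hn
  have hR0 : 0 ≤ R := (norm_nonneg _).trans hR
  have h1 : ‖s+1‖ ≤ R+1 := (norm_add_le _ _).trans (by simpa using hR)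
  have h2 : ((n:ℝ)/2)^(-s.re-2) ≤ 2^(R+2) * (1/(n:ℝ)^2) := by
    rw [Real.div_rpow (by linarith) (by norm_num), div_eq_mul_inv, ← Real.rpow_neg (by norm_num), mul_comm]
    apply mul_le_mul _ _ (by positivity) (by positivity)
    · apply Real.rpow_le_rpow_of_exponent_le (by norm_num)
      have := (Complex.re_le_norm s).trans hR
      linarith
    · calc (n:ℝ)^(-s.re-2) ≤ (n:ℝ)^(-2:ℝ) := Real.rpow_le_rpow_of_exponent_le hn' (by linarith)
        _ = _ := by rw [Real.rpow_neg (by linarith)]; norm_cast; simp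
  calc _ ≤ 2 * (R * (R+1) * (2^(R+2) * (1/(n:ℝ)^2))) := by gcongr
    _ = _ := by ring

lemma emTerm_diff (x : ℝ) (hx0 : 0 < x) (n : ℕ) (hn : 1 ≤ n) (s : ℂ) (hs1 : s ≠ 1) :
    DifferentiableAt ℂ (emTerm x n) s := by
  have hn' : (1:ℝ) ≤ n := by exact_mod_cast hn
  have e1 : (n:ℂ)+x ≠ 0 := by
    have : (n:ℝ)+x ≠ 0 := by linarith
    exact_mod_cast this
  have e2 : (n:ℂ)+x+1/2 ≠ 0 := by
    have : (((n:ℝ)+x+1/2:ℝ):ℂ) ≠ 0 := by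
      rw [Complex.ofReal_ne_zero]; linarith
    push_cast at this; exact this
  have e3 : (n:ℂ)+x-1/2 ≠ 0 := by
    have : (((n:ℝ)+x-1/2:ℝ):ℂ) ≠ 0 := by
      rw [Complex.ofReal_ne_zero]; linarith
    push_cast at this; exact this
  have e4 : 1 - s ≠ 0 := sub_ne_zero.mpr hs1.symm
  have hd : DifferentiableAt ℂ (fun s : ℂ => 1 - s) s := by fun_prop
  unfold emTerm
  apply DifferentiableAt.sub
  · apply DifferentiableAt.div (by fun_prop)
    · exact differentiableAt_id.const_cpow (Or.inl e1)
    · rw [Ne, Complex.cpow_eq_zero_iff]; tauto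
  · exact ((hd.const_cpow (Or.inl e2)).div hd e4).sub ((hd.const_cpow (Or.inl e3)).div hd e4)

lemma emTerm_summ (x : ℝ) (hx0 : 0 < x) (N : ℕ) (hN : 1 ≤ N) (s : ℂ) (hs : 0 < s.re) (hs1 : s ≠ 1) :
    Summable (fun n => emTerm x (N+n) s) := by
  refine Summable.of_norm_bounded ((summ_sq N).mul_left (2 * (‖s‖ * (‖s‖+1) * 2^(‖s‖+2)))) (fun n => ?_)
  exact emTerm_loc x hx0 (N+n) (by omega) ‖s‖ s hs hs1 le_rfl

lemma em_formula_gt (x : ℝ) (hx0 : 0 < x) (hx1 : x ≤ 1) (N : ℕ) (hN : 1 ≤ N) (s : ℂ) (hs : 1 < s.re) :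
    HurwitzZeta.hurwitzZeta (x : UnitAddCircle) s = ∑ n ∈ range N, 1/((n:ℂ)+x)^s - ((N:ℂ)+x-1/2)^(1-s)/(1-s) + ∑' n, emTerm x (N+n) s := by
  have hs1 : s ≠ 1 := by intro h; rw [h] at hs; simp at hs
  have h1 := (emTerm_summ x hx0 N hN s (by linarith) hs1).hasSum.tendsto_sum_nat
  have h2 := (HurwitzZeta.hasSum_hurwitzZeta_of_one_lt_re (a := x) ⟨hx0.le, hx1⟩ hs)
  have h2' := ((hasSum_nat_add_iff' N).mpr h2).tendsto_sum_nat
  have h3 : Filter.Tendsto (fun m : ℕ => ((N+m:ℕ):ℝ)+x-1/2) Filter.atTop Filter.atTop := by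
    have : Filter.Tendsto (fun m : ℕ => (m:ℝ)) Filter.atTop Filter.atTop := tendsto_natCast_atTop_atTop
    refine Filter.tendsto_atTop_mono (fun m => ?_) this
    have : (1:ℝ) ≤ N := by exact_mod_cast hN
    push_cast; linarith
  have h4 : Filter.Tendsto (fun m : ℕ => (((N+m:ℕ):ℂ)+x-1/2)^(1-s)/(1-s)) Filter.atTop (nhds 0) := by
    rw [tendsto_zero_iff_norm_tendsto_zero]
    have h5 := ((tendsto_rpow_neg_atTop (show 0 < s.re - 1 by linarith)).comp h3).div_const ‖1-s‖
    rw [zero_div] at h5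
    refine h5.congr (fun m => ?_)
    have hN' : (1:ℝ) ≤ N := by exact_mod_cast hN
    have hp : 0 < ((N+m:ℕ):ℝ)+x-1/2 := by
      push_cast; have : (0:ℝ) ≤ m := by positivity
      linarith
    have := Complex.norm_cpow_eq_rpow_re_of_pos hp (1-s)
    push_cast at this ⊢
    rw [norm_div, this]
    simp
  have h6 := h2'.sub (h4.sub_const (((N:ℂ)+x-1/2)^(1-s)/(1-s)))
  have key : ∀ m : ℕ, ∑ n ∈ range m, emTerm x (N+n) s = ∑ i ∈ range m, 1 / (((i+N:ℕ):ℂ)+x)^s - ((((N+m:ℕ):ℂ)+x-1/2)^(1-s)/(1-s) - ((N:ℂ)+x-1/2)^(1-s)/(1-s)) := by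
    intro m
    have := sum_range_sub (fun m : ℕ => (((N+m:ℕ):ℂ)+x-1/2)^(1-s)/(1-s)) m
    rw [show ((N:ℂ)+x-1/2)^(1-s)/(1-s) = (((N+0:ℕ):ℂ)+x-1/2)^(1-s)/(1-s) by simp, ← this, ← sum_sub_distrib]
    apply sum_congr rfl
    intro i _
    unfold emTerm
    rw [show (((N+(i+1):ℕ):ℂ)+x-1/2) = ((N+i:ℕ):ℂ)+x+1/2 by push_cast; ring, add_comm i N]
  have := tendsto_nhds_unique (h1.congr key) h6
  rw [this]
  ring

lemma em_formula (x : ℝ) (hx0 : 0 < x) (hx1 : x ≤ 1) (N : ℕ) (hN : 1 ≤ N) (s : ℂ) (hs : 0 < s.re) (hs1 : s ≠ 1) :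
    HurwitzZeta.hurwitzZeta (x : UnitAddCircle) s = ∑ n ∈ range N, 1/((n:ℂ)+x)^s - ((N:ℂ)+x-1/2)^(1-s)/(1-s) + ∑' n, emTerm x (N+n) s := by
  have hN' : (1:ℝ) ≤ N := by exact_mod_cast hN
  have hU : IsOpen {s : ℂ | 0 < s.re ∧ s ≠ 1} :=
    (isOpen_lt continuous_const Complex.continuous_re).inter isOpen_ne
  have e3 : (N:ℂ)+x-1/2 ≠ 0 := by
    have : (((N:ℝ)+x-1/2:ℝ):ℂ) ≠ 0 := by
      rw [Complex.ofReal_ne_zero]; linarith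
    push_cast at this; exact this
  have hf : AnalyticOnNhd ℂ (HurwitzZeta.hurwitzZeta (x : UnitAddCircle)) {s : ℂ | 0 < s.re ∧ s ≠ 1} :=
    DifferentiableOn.analyticOnNhd (fun s hs => (HurwitzZeta.differentiableAt_hurwitzZeta _ hs.2).differentiableWithinAt) hU
  have hg : AnalyticOnNhd ℂ (fun s => ∑ n ∈ range N, 1/((n:ℂ)+x)^s - ((N:ℂ)+x-1/2)^(1-s)/(1-s) + ∑' n, emTerm x (N+n) s) {s : ℂ | 0 < s.re ∧ s ≠ 1} := by
    apply DifferentiableOn.analyticOnNhd _ hU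
    intro s hs
    apply DifferentiableAt.differentiableWithinAt
    have hd : DifferentiableAt ℂ (fun s : ℂ => 1 - s) s := by fun_prop
    have e4 : 1 - s ≠ 0 := sub_ne_zero.mpr hs.2.symm
    apply DifferentiableAt.add
    · apply DifferentiableAt.sub
      · apply DifferentiableAt.fun_sum
        intro i _
        have e1 : (i:ℂ)+x ≠ 0 := by
          have : (i:ℝ)+x ≠ 0 := by positivity
          exact_mod_cast this
        apply DifferentiableAt.div (by fun_prop)
        · exact differentiableAt_id.const_cpow (Or.inl e1)
        · rw [Ne, Complex.cpow_eq_zero_iff]; tauto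
      · exact ((hd.const_cpow (Or.inl e3)).div hd e4)
    · have hV : IsOpen ({s : ℂ | 0 < s.re ∧ s ≠ 1} ∩ Metric.ball 0 (‖s‖+1)) := hU.inter Metric.isOpen_ball
      have := differentiableOn_tsum_of_summable_norm (F := fun n s => emTerm x (N+n) s)
        ((summ_sq N).mul_left (2 * ((‖s‖+1) * ((‖s‖+1)+1) * 2^((‖s‖+1)+2))))
        (fun n w hw => (emTerm_diff x hx0 (N+n) (by omega) w hw.1.2).differentiableWithinAt) hV
        (fun n w hw => emTerm_loc x hx0 (N+n) (by omega) (‖s‖+1) w hw.1.1 hw.1.2 (by have h := hw.2; rw [mem_ball_zero_iff] at h; exact h.le))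
      exact this.differentiableAt (hV.mem_nhds ⟨hs, by simp⟩)
  refine hf.eqOn_of_preconnected_of_eventuallyEq hg preconn_U (z₀ := 2) (by constructor <;> norm_num) ?_ ⟨hs, hs1⟩
  have : {s : ℂ | 1 < s.re} ∈ nhds (2:ℂ) := (isOpen_lt continuous_const Complex.continuous_re).mem_nhds (by norm_num)
  filter_upwards [this] with w hw
  exact em_formula_gt x hx0 hx1 N hN w hw


lemma tail_sq (N : ℕ) (hN : 1 ≤ N) : ∑' n : ℕ, 1 / ((N+n:ℕ):ℝ)^2 ≤ 2 / (N:ℝ) := by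
  have hN' : (1:ℝ) ≤ N := by exact_mod_cast hN
  refine Real.tsum_le_of_sum_range_le (fun n => by positivity) (fun m => ?_)
  have : ∑ i ∈ range m, 1 / ((N+i:ℕ):ℝ)^2 ≤ 2/N - 2/((N+m:ℕ):ℝ) := by
    induction m with
    | zero => simp
    | succ m ih =>
      rw [sum_range_succ]
      have h : 1 / ((N+m:ℕ):ℝ)^2 ≤ 2/((N+m:ℕ):ℝ) - 2/((N+(m+1):ℕ):ℝ) := by
        have : (1:ℝ) ≤ ((N+m:ℕ):ℝ) := by exact_mod_cast (by omega)
        rw [show ((N+(m+1):ℕ):ℝ) = ((N+m:ℕ):ℝ) + 1 by push_cast; ring]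
        generalize ((N+m:ℕ):ℝ) = v at *
        rw [div_sub_div _ _ (by positivity) (by positivity), div_le_div_iff₀ (by positivity) (by positivity)]
        nlinarith [mul_nonneg (by linarith : (0:ℝ) ≤ v) (by linarith : (0:ℝ) ≤ v - 1)]
      linarith
  have h2 : 0 ≤ 2/((N+m:ℕ):ℝ) := by positivity
  linarith

lemma em_tail (σ t x : ℝ) (h0 : 0 < σ) (h1 : σ < 1) (hx0 : 0 < x) (N : ℕ) (hN : 1 ≤ N) :
    ‖∑' n, emTerm x (N+n) ((σ:ℂ)+t*I)‖ ≤ 64 * (1+|t|)^2 * (N:ℝ)^(-σ-1) := by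
  have hN' : (1:ℝ) ≤ N := by exact_mod_cast hN
  have ht := abs_nonneg t
  set s : ℂ := (σ:ℂ)+t*I with hs
  have hre : s.re = σ := by simp [hs]
  have hs1 : s ≠ 1 := by intro h; rw [h] at hre; simp at hre; linarith
  have n1 : ‖s‖ ≤ 1+|t| := by
    refine (norm_add_le _ _).trans ?_
    simp [abs_of_pos h0]; linarith
  have n2 : ‖s+1‖ ≤ 2*(1+|t|) := by
    refine (norm_add_le _ _).trans ?_
    rw [norm_one]; linarith
  have hb : ∀ n : ℕ, ‖emTerm x (N+n) s‖ ≤ (32 * (1+|t|)^2 * (N:ℝ)^(-σ)) * (1 / ((N+n:ℕ):ℝ)^2) := by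
    intro n
    refine (emTerm_bd x hx0 (N+n) (by omega) s (by rw [hre]; exact h0) hs1).trans ?_
    rw [hre]
    have hv : (N:ℝ) ≤ ((N+n:ℕ):ℝ) := by exact_mod_cast (by omega)
    generalize ((N+n:ℕ):ℝ) = v at *
    have hv0 : 0 < v := by linarith
    have h3 : (v/2)^(-σ-2) ≤ 8 * ((N:ℝ)^(-σ) * (1/v^2)) := by
      rw [Real.div_rpow hv0.le (by norm_num), div_eq_mul_inv, ← Real.rpow_neg (by norm_num), mul_comm]
      apply mul_le_mul _ _ (by positivity) (by positivity)
      · calc (2:ℝ)^(-(-σ-2)) ≤ 2^(3:ℝ) := Real.rpow_le_rpow_of_exponent_le (by norm_num) (by linarith)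
          _ = 8 := by norm_num
      · rw [show -σ-2 = -σ + -2 by ring, Real.rpow_add hv0, Real.rpow_neg hv0.le 2]
        rw [Real.rpow_two, one_div]
        gcongr ?_ * _
        exact Real.rpow_le_rpow_of_nonpos (by linarith) hv (by linarith)
    calc _ ≤ 2 * ((1+|t|) * (2*(1+|t|)) * (8 * ((N:ℝ)^(-σ) * (1/v^2)))) := by gcongr
      _ = _ := by ring
  have := tsum_of_norm_bounded ((summ_sq N).mul_left (32 * (1+|t|)^2 * (N:ℝ)^(-σ))).hasSum hb
  rw [tsum_mul_left] at this
  refine this.trans ?_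
  calc _ ≤ 32 * (1+|t|)^2 * (N:ℝ)^(-σ) * (2/N) := by gcongr; exact tail_sq N hN
    _ = _ := by
      rw [show -σ-1 = -σ + -1 by ring, Real.rpow_add (by linarith), Real.rpow_neg_one]; ring

lemma hz_crit (σ : ℝ) (h0 : 0 < σ) (h1 : σ < 1) : ∃ C : ℝ, 0 ≤ C ∧ ∀ t x : ℝ, 0 < x → x ≤ 1 →
    ‖HurwitzZeta.hurwitzZeta (x : UnitAddCircle) ((σ:ℂ)+t*I)‖ ≤ C * (x^(-σ) * (1+|t|)^((1-σ)/2)) := by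
  obtain ⟨C, hC0, hC⟩ := head_bd σ h0 h1
  have h1' : 0 < 1 - σ := by linarith
  refine ⟨1 + C + 8/(1-σ) + 64, by positivity, fun t x hx0 hx1 => ?_⟩
  have ht := abs_nonneg t
  set T := 1+|t| with hT
  have hT1 : 1 ≤ T := by linarith
  have hT0 : 0 < T := by linarith
  obtain ⟨k, hk1, hk2⟩ := exists_nat_pow_near (Real.one_le_rpow hT1 (by norm_num : (0:ℝ) ≤ 3/2)) (by norm_num : (1:ℝ) < 2)
  have hJ1 : T^(3/2:ℝ) ≤ ((2^(k+1):ℕ):ℝ) := by push_cast; exact hk2.le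
  have hJ2 : ((2^(k+1):ℕ):ℝ) ≤ 2*T^(3/2:ℝ) := by push_cast; rw [pow_succ]; linarith
  have hN : 1 ≤ 2^(k+1) := Nat.one_le_two_pow
  have hhead := hC t x hx0 hx1 (k+1) hJ2
  generalize hNN : 2^(k+1) = N at *
  have hN' : (1:ℝ) ≤ N := by exact_mod_cast hN
  set s : ℂ := (σ:ℂ)+t*I with hs
  have hre : s.re = σ := by simp [hs]
  have hs1 : s ≠ 1 := by intro h; rw [h] at hre; simp at hre; linarith
  rw [em_formula x hx0 hx1 N hN s (by rw [hre]; exact h0) hs1]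
  rw [range_eq_Ico, Finset.sum_eq_sum_Ico_succ_bot (by omega)]
  have hTT : 1 ≤ T^((1-σ)/2) := Real.one_le_rpow hT1 (by linarith)
  have hxx : 1 ≤ x^(-σ) := Real.one_le_rpow_of_pos_of_le_one_of_nonpos hx0 hx1 (by linarith)
  have hTe : T^(1/2-3*σ/2) ≤ T^((1-σ)/2) := Real.rpow_le_rpow_of_exponent_le hT1 (by linarith)
  have b0 : ‖1/(((0:ℕ):ℂ)+x)^s‖ ≤ x^(-σ) * T^((1-σ)/2) := by
    rw [Nat.cast_zero, zero_add, norm_div, norm_one, Complex.norm_cpow_eq_rpow_re_of_pos hx0, hre, one_div, ← Real.rpow_neg hx0.le]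
    exact le_mul_of_one_le_right (by positivity) hTT
  have b1 : ‖∑ n ∈ Ico (0+1) N, 1/((n:ℂ)+x)^s‖ ≤ C * (x^(-σ) * T^((1-σ)/2)) := by
    refine hhead.trans ?_
    gcongr
    exact le_mul_of_one_le_left (by positivity) hxx
  have hden : (1-σ)/2*T ≤ ‖1-s‖ := by
    have a1 := Complex.abs_re_le_norm (1-s)
    have a2 := Complex.abs_im_le_norm (1-s)
    have a3 : (1-s).re = 1-σ := by simp [hre]
    have a4 : (1-s).im = -t := by simp [hs]
    rw [a3, abs_of_pos h1'] at a1
    rw [a4, abs_neg] at a2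
    rw [hT]; nlinarith
  have b2 : ‖((N:ℂ)+x-1/2)^(1-s)/(1-s)‖ ≤ 8/(1-σ) * (x^(-σ) * T^((1-σ)/2)) := by
    have hp : 0 < (N:ℝ)+x-1/2 := by linarith
    have e := Complex.norm_cpow_eq_rpow_re_of_pos hp (1-s)
    push_cast at e
    rw [norm_div, e]
    have a3 : (1-s).re = 1-σ := by simp [hre]
    rw [a3]
    have n1 : ((N:ℝ)+x-1/2)^(1-σ) ≤ 4 * T^(3/2*(1-σ)) := by
      calc ((N:ℝ)+x-1/2)^(1-σ) ≤ (4*T^(3/2:ℝ))^(1-σ) := by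
            apply Real.rpow_le_rpow hp.le _ h1'.le
            linarith
        _ = 4^(1-σ) * T^(3/2*(1-σ)) := by rw [Real.mul_rpow (by norm_num) (by positivity), ← Real.rpow_mul hT0.le]
        _ ≤ _ := by
            gcongr
            calc (4:ℝ)^(1-σ) ≤ 4^(1:ℝ) := Real.rpow_le_rpow_of_exponent_le (by norm_num) (by linarith)
              _ = 4 := by norm_num
    calc _ ≤ 4 * T^(3/2*(1-σ)) / ((1-σ)/2*T) := by gcongr
      _ = 8/(1-σ) * T^(1/2-3*σ/2) := by
          rw [show 1/2-3*σ/2 = 3/2*(1-σ) - 1 by ring, Real.rpow_sub_one hT0.ne']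
          field_simp; norm_num
      _ ≤ _ := by
          gcongr
          exact hTe.trans (le_mul_of_one_le_left (by positivity) hxx)
  have b3 : ‖∑' n, emTerm x (N+n) s‖ ≤ 64 * (x^(-σ) * T^((1-σ)/2)) := by
    refine (em_tail σ t x h0 h1 hx0 N hN).trans ?_
    have n1 : (N:ℝ)^(-σ-1) ≤ T^(3/2*(-σ-1)) := by
      rw [Real.rpow_mul hT0.le]
      exact Real.rpow_le_rpow_of_nonpos (by positivity) hJ1 (by linarith)
    calc _ ≤ 64 * T^2 * T^(3/2*(-σ-1)) := by gcongr
      _ = 64 * T^(1/2-3*σ/2) := by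
          rw [mul_assoc, ← Real.rpow_natCast, ← Real.rpow_add hT0]; congr 2; push_cast; ring
      _ ≤ _ := by
          gcongr
          exact hTe.trans (le_mul_of_one_le_left (by positivity) hxx)
  calc _ ≤ _ := (norm_add_le _ _).trans (add_le_add_left ((norm_sub_le _ _).trans (add_le_add_left (norm_add_le _ _) _)) _)
    _ ≤ _ := by linarith


lemma tau_summ (c : ℝ) (hc : 1 < c) : Summable (fun d : ℕ => (d:ℝ)^(-c) * (d.divisors.card : ℝ)) := by
  have h1 : LSeriesSummable 1 (c:ℂ) := LSeriesSummable_one_iff.mpr (by simpa using hc)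
  have h2 := (h1.convolution h1).norm
  refine h2.congr (fun d => ?_)
  rcases Nat.eq_zero_or_pos d with rfl | hd
  · simp
  rw [LSeries.norm_term_eq, if_neg hd.ne', LSeries.convolution_def]
  simp only [Pi.one_apply, mul_one, sum_const, nsmul_eq_mul]
  rw [Real.rpow_neg (by positivity), Complex.norm_natCast, Complex.ofReal_re]
  have : d.divisorsAntidiagonal.card = d.divisors.card := by
    rw [← Nat.map_div_right_divisors, card_map]
  rw [this]; field_simp

lemma cnt (d n e : ℕ) (hd : 1 ≤ d) : ((Icc 1 d).filter (fun k => k * e ≡ n [MOD d])).card ≤ Nat.gcd e d := by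
  set m := d / Nat.gcd d e with hm
  have hg : 0 < Nat.gcd d e := Nat.gcd_pos_of_pos_left _ hd
  have hdm : m * Nat.gcd d e = d := Nat.div_mul_cancel (Nat.gcd_dvd_left _ _)
  have hm0 : 0 < m := by
    rcases Nat.eq_zero_or_pos m with h | h
    · rw [h] at hdm; omega
    · exact h
  rw [Nat.gcd_comm e d, ← card_range (Nat.gcd d e)]
  apply card_le_card_of_injOn (fun k => (k-1)/m)
  · intro k hk
    simp only [coe_filter, mem_Icc, Set.mem_ofPred_eq] at hk
    simp only [coe_range, Set.mem_Iio]
    rw [Nat.div_lt_iff_lt_mul hm0, mul_comm, hdm]; omega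
  · intro k hk l hl hkl
    simp only [coe_filter, mem_Icc, Set.mem_ofPred_eq] at hk hl
    have h1 : k * e ≡ l * e [MOD d] := hk.2.trans hl.2.symm
    have h2 : k ≡ l [MOD m] := Nat.ModEq.cancel_right_div_gcd hd h1
    have h3 : k - 1 ≡ l - 1 [MOD m] := by
      apply Nat.ModEq.add_right_cancel' 1
      rwa [Nat.sub_add_cancel hk.1.1, Nat.sub_add_cancel hl.1.1]
    simp only at hkl
    have h4 : k - 1 = l - 1 := by
      rw [← Nat.div_add_mod (k-1) m, ← Nat.div_add_mod (l-1) m, hkl, h3]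
    omega

lemma pow_sum (σ : ℝ) (h0 : 0 < σ) (h1 : σ < 1) (m : ℕ) :
    ∑ k ∈ Icc 1 m, (k:ℝ)^(-σ) ≤ (m:ℝ)^(1-σ)/(1-σ) := by
  have h1' : 0 < 1 - σ := by linarith
  induction m with
  | zero => simp; positivity
  | succ m ih =>
    rw [sum_Icc_succ_top (by omega)]
    have hv : (0:ℝ) < ((m+1:ℕ):ℝ) := by positivity
    have hm : (m:ℝ) = ((m+1:ℕ):ℝ) * (1 + -1/((m+1:ℕ):ℝ)) := by field_simp; push_cast; ring
    have hv1 : (1:ℝ) ≤ ((m+1:ℕ):ℝ) := by exact_mod_cast (by omega)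
    have hm0 : (0:ℝ) ≤ (1 + -1/((m+1:ℕ):ℝ)) := by
      rw [neg_div, ← sub_eq_add_neg, sub_nonneg, div_le_one hv]; exact hv1
    rw [hm, Real.mul_rpow hv.le hm0] at ih
    generalize ((m+1:ℕ):ℝ) = v at *
    have hB := rpow_one_add_le_one_add_mul_self (s := -1/v) (by linarith) h1'.le (by linarith : 1 - σ ≤ 1)
    have : v^(-σ) = v^(1-σ) * (1/v) := by
      rw [show -σ = (1-σ) - 1 by ring, Real.rpow_sub_one hv.ne']; ring
    rw [this]
    rw [le_div_iff₀ h1'] at ih ⊢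
    have hp : 0 < v^(1-σ) := by positivity
    have := mul_le_mul_of_nonneg_left hB hp.le
    have e : v^(1-σ) * (1 + (1-σ)*(-1/v)) = v^(1-σ) - v^(1-σ)*(1/v)*(1-σ) := by ring
    rw [e] at this
    rw [add_mul]; linarith

lemma gcd_sum (σ : ℝ) (h0 : 0 < σ) (h1 : σ < 1) (d : ℕ) (hd : 1 ≤ d) :
    ∑ e ∈ Icc 1 d, (Nat.gcd e d : ℝ) * ((e:ℝ)/d)^(-σ) ≤ (d:ℝ) * d.divisors.card / (1-σ) := by
  have h1' : 0 < 1 - σ := by linarith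
  calc _ ≤ ∑ e ∈ Icc 1 d, ∑ g ∈ d.divisors, if g ∣ e then (g:ℝ) * ((e:ℝ)/d)^(-σ) else 0 := by
        apply sum_le_sum
        intro e _
        have hmem : Nat.gcd e d ∈ d.divisors := Nat.mem_divisors.mpr ⟨Nat.gcd_dvd_right _ _, by omega⟩
        have := single_le_sum (f := fun g : ℕ => if g ∣ e then (g:ℝ) * ((e:ℝ)/d)^(-σ) else 0) (fun g _ => by
          split_ifs <;> positivity) hmem
        simpa [Nat.gcd_dvd_left] using this
    _ = ∑ g ∈ d.divisors, ∑ e ∈ Icc 1 d, if g ∣ e then (g:ℝ) * ((e:ℝ)/d)^(-σ) else 0 := sum_comm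
    _ ≤ ∑ g ∈ d.divisors, (d:ℝ)/(1-σ) := by
        apply sum_le_sum
        intro g hg
        obtain ⟨⟨m, rfl⟩, -⟩ := Nat.mem_divisors.mp hg
        have hg0 : 0 < g := Nat.pos_of_mul_pos_right hd
        have hm0 : 0 < m := Nat.pos_of_mul_pos_left hd
        have hg0' : (0:ℝ) < g := by exact_mod_cast hg0
        have hm0' : (0:ℝ) < m := by exact_mod_cast hm0
        rw [← sum_filter]
        have himg : (Icc 1 (g*m)).filter (fun e => g ∣ e) = (Icc 1 m).image (fun k => g*k) := by
          ext e
          simp only [mem_filter, mem_Icc, mem_image]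
          constructor
          · rintro ⟨⟨a, b⟩, ⟨k, rfl⟩⟩
            exact ⟨k, ⟨Nat.pos_of_mul_pos_left a, Nat.le_of_mul_le_mul_left b hg0⟩, rfl⟩
          · rintro ⟨k, ⟨a, b⟩, rfl⟩
            exact ⟨⟨Nat.mul_pos hg0 a, Nat.mul_le_mul_left g b⟩, dvd_mul_right _ _⟩
        rw [himg, sum_image (fun a _ b _ h => Nat.eq_of_mul_eq_mul_left hg0 h)]
        have : ∀ k ∈ Icc 1 m, (g:ℝ) * (((g*k:ℕ):ℝ)/((g*m:ℕ):ℝ))^(-σ) = g * (m:ℝ)^σ * (k:ℝ)^(-σ) := by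
          intro k hk
          push_cast
          rw [mul_div_mul_left _ _ hg0'.ne', Real.div_rpow (by positivity) hm0'.le, Real.rpow_neg hm0'.le]
          field_simp
        rw [sum_congr rfl this, ← mul_sum]
        calc _ ≤ g * (m:ℝ)^σ * ((m:ℝ)^(1-σ)/(1-σ)) := by gcongr; exact pow_sum σ h0 h1 m
          _ = g * ((m:ℝ)^σ * (m:ℝ)^(1-σ))/(1-σ) := by ring
          _ = _ := by rw [← Real.rpow_add hm0']; simp
    _ = _ := by rw [sum_const, nsmul_eq_mul]; ring

theorem stmt14_aux (a b : ℝ) (ha : 0 < a) (hb : max a (2 - a) < b) (σ : ℝ)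
    (hσ1 : max (1 - (b - a) / 2) 0 < σ) (hσ2 : σ < min a 1) :
    ∃ C : ℝ, ∀ (t : ℝ) (n : ℕ), 
      Summable (fun d : ℕ =>
        (d : ℂ) ^ ((a : ℂ) - b - 2 * ((σ : ℂ) + t * I)) *
          ∑ e ∈ (Finset.Icc 1 d ×ˢ Finset.Icc 1 d).filter
              (fun e : ℕ × ℕ => e.1 * e.2 ≡ n [MOD d]),
            HurwitzZeta.hurwitzZeta (((e.1 : ℝ) / d : ℝ) : UnitAddCircle) ((σ : ℂ) + t * I - a)
              * HurwitzZeta.hurwitzZeta (((e.2 : ℝ) / d : ℝ) : UnitAddCircle) ((σ : ℂ) + t * I)) ∧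
      ‖∑' d : ℕ,
          (d : ℂ) ^ ((a : ℂ) - b - 2 * ((σ : ℂ) + t * I)) *
            ∑ e ∈ (Finset.Icc 1 d ×ˢ Finset.Icc 1 d).filter
                (fun e : ℕ × ℕ => e.1 * e.2 ≡ n [MOD d]),
            HurwitzZeta.hurwitzZeta (((e.1 : ℝ) / d : ℝ) : UnitAddCircle) ((σ : ℂ) + t * I - a)
              * HurwitzZeta.hurwitzZeta (((e.2 : ℝ) / d : ℝ) : UnitAddCircle) ((σ : ℂ) + t * I)‖
        ≤ C * (1 + |t|) ^ (a - 3 * σ / 2 + 1) := by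
  obtain ⟨hs1, hs0⟩ := max_lt_iff.mp hσ1
  obtain ⟨hsa, hsone⟩ := lt_min_iff.mp hσ2
  have h1' : 0 < 1 - σ := by linarith
  obtain ⟨C1, hC10, hC1⟩ := hz_neg (σ-a) (by linarith)
  obtain ⟨C2, hC20, hC2⟩ := hz_crit σ hs0 hsone
  set c : ℝ := b - a + 2*σ - 1 with hc
  have hsum := tau_summ c (by linarith)
  refine ⟨C1 * C2 / (1-σ) * ∑' d : ℕ, (d:ℝ)^(-c) * (d.divisors.card : ℝ), fun t n => ?_⟩
  set T := 1 + |t| with hT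
  have hT0 : 0 < T := by positivity
  set K := C1 * C2 / (1-σ) * T^(a-3*σ/2+1) with hK
  have hK0 : 0 ≤ K := by positivity
  have key : ∀ d : ℕ, ‖(d : ℂ) ^ ((a : ℂ) - b - 2 * ((σ : ℂ) + t * I)) *
          ∑ e ∈ (Finset.Icc 1 d ×ˢ Finset.Icc 1 d).filter
              (fun e : ℕ × ℕ => e.1 * e.2 ≡ n [MOD d]),
            HurwitzZeta.hurwitzZeta (((e.1 : ℝ) / d : ℝ) : UnitAddCircle) ((σ : ℂ) + t * I - a)
              * HurwitzZeta.hurwitzZeta (((e.2 : ℝ) / d : ℝ) : UnitAddCircle) ((σ : ℂ) + t * I)‖ ≤ K * ((d:ℝ)^(-c) * (d.divisors.card : ℝ)) := by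
    intro d
    rcases Nat.eq_zero_or_pos d with rfl | hd
    · simp
    have hd' : (0:ℝ) < d := by exact_mod_cast hd
    have hn : ‖(d : ℂ) ^ ((a : ℂ) - b - 2 * ((σ : ℂ) + t * I))‖ = (d:ℝ)^(-c) * (d:ℝ)⁻¹ := by
      have := Complex.norm_cpow_eq_rpow_re_of_pos hd' ((a : ℂ) - b - 2 * ((σ : ℂ) + t * I))
      rw [Complex.ofReal_natCast] at this
      rw [this, ← Real.rpow_neg_one, ← Real.rpow_add hd']
      congr 1
      simp; ring
    rw [norm_mul, hn]
    set M := C1 * C2 * T^(a-3*σ/2+1) with hM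
    have hS : ‖∑ e ∈ (Finset.Icc 1 d ×ˢ Finset.Icc 1 d).filter
              (fun e : ℕ × ℕ => e.1 * e.2 ≡ n [MOD d]),
            HurwitzZeta.hurwitzZeta (((e.1 : ℝ) / d : ℝ) : UnitAddCircle) ((σ : ℂ) + t * I - a)
              * HurwitzZeta.hurwitzZeta (((e.2 : ℝ) / d : ℝ) : UnitAddCircle) ((σ : ℂ) + t * I)‖ ≤ M * ((d:ℝ) * d.divisors.card / (1-σ)) := by
      calc _ ≤ ∑ e ∈ (Finset.Icc 1 d ×ˢ Finset.Icc 1 d).filter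
              (fun e : ℕ × ℕ => e.1 * e.2 ≡ n [MOD d]), M * ((e.2:ℝ)/d)^(-σ) := by
            refine (norm_sum_le _ _).trans (sum_le_sum ?_)
            intro e he
            simp only [mem_filter, mem_product, mem_Icc] at he
            have p1 : (0:ℝ) < (e.2:ℝ)/d := by
              have : (0:ℝ) < e.2 := by exact_mod_cast he.1.2.1
              positivity
            have p2 : (e.2:ℝ)/d ≤ 1 := by
              rw [div_le_one hd']; exact_mod_cast he.1.2.2
            have q1 := hC1 t ((e.1:ℝ)/d)
            have q2 := hC2 t _ p1 p2
            rw [norm_mul]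
            have e1 : (σ : ℂ) + t * I - a = ((σ-a:ℝ):ℂ) + t * I := by push_cast; ring
            rw [e1]
            calc _ ≤ _ := mul_le_mul q1 q2 (norm_nonneg _) (by positivity)
              _ = C1*C2*(T^(1/2-(σ-a)) * T^((1-σ)/2)) * ((e.2:ℝ)/d)^(-σ) := by ring
              _ = _ := by
                rw [hM, ← Real.rpow_add hT0]; congr 3; ring
        _ = M * ∑ e ∈ (Finset.Icc 1 d ×ˢ Finset.Icc 1 d).filter
              (fun e : ℕ × ℕ => e.1 * e.2 ≡ n [MOD d]), ((e.2:ℝ)/d)^(-σ) := by rw [mul_sum]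
        _ ≤ _ := by
            gcongr
            refine le_trans ?_ (gcd_sum σ hs0 hsone d hd)
            rw [sum_filter, sum_product_right]
            apply sum_le_sum
            intro y _
            rw [← sum_filter]; dsimp only; rw [sum_const, nsmul_eq_mul]
            gcongr
            exact cnt d n y hd
    calc _ ≤ (d:ℝ)^(-c) * (d:ℝ)⁻¹ * (M * ((d:ℝ) * d.divisors.card / (1-σ))) := by gcongr
      _ = _ := by rw [hK, hM]; field_simp
  refine ⟨Summable.of_norm_bounded (hsum.mul_left K) key, ?_⟩
  have := tsum_of_norm_bounded (hsum.mul_left K).hasSum key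
  refine this.trans (le_of_eq ?_)
  rw [tsum_mul_left, hK]; ring


theorem stmt14 (a b : ℝ) (ha : 0 < a) (hb : max a (2 - a) < b) (σ : ℝ)
    (hσ1 : max (1 - (b - a) / 2) 0 < σ) (hσ2 : σ < min a 1) :
    ∃ C : ℝ, ∀ (t : ℝ) (n : ℕ), 0 < n →
      Summable (fun d : ℕ =>
        (d : ℂ) ^ ((a : ℂ) - b - 2 * ((σ : ℂ) + t * I)) *
          ∑ e ∈ (Finset.Icc 1 d ×ˢ Finset.Icc 1 d).filter
              (fun e : ℕ × ℕ => e.1 * e.2 ≡ n [MOD d]),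
            hzeta ((σ : ℂ) + t * I - a) ((e.1 : ℝ) / d)
              * hzeta ((σ : ℂ) + t * I) ((e.2 : ℝ) / d)) ∧
      ‖∑' d : ℕ,
          (d : ℂ) ^ ((a : ℂ) - b - 2 * ((σ : ℂ) + t * I)) *
            ∑ e ∈ (Finset.Icc 1 d ×ˢ Finset.Icc 1 d).filter
                (fun e : ℕ × ℕ => e.1 * e.2 ≡ n [MOD d]),
              hzeta ((σ : ℂ) + t * I - a) ((e.1 : ℝ) / d)
                * hzeta ((σ : ℂ) + t * I) ((e.2 : ℝ) / d)‖
        ≤ C * (1 + |t|) ^ (a - 3 * σ / 2 + 1) := by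
  obtain ⟨C, hC⟩ := stmt14_aux a b ha hb σ hσ1 hσ2
  exact ⟨C, fun t n _ => hC t n⟩
end

section
/- Let a and b be real numbers with a > 1 and b > 1. Then there is a constant C = C(a,b) such that for every integer n ≥ 2, | S_{a,b}(n) − [Γ(a+1)Γ(b+1)/Γ(a+b+2)]·[ζ(a+1)ζ(b+1)/ζ(a+b+2)]·σ_{a+b+1}(n) | ≤ C·n^{a+b}. -/
open Finset

/-- `σ_a(n) = ∑_{d ∣ n} d^a` for real `a`. -/
noncomputable def sigmaR (a : ℝ) (n : ℕ) : ℝ := ∑ d ∈ n.divisors, (d : ℝ) ^ a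

/-- `S_{a,b}(n) = ∑_{k=1}^{n-1} σ_a(k) σ_b(n-k)`. -/
noncomputable def SR (a b : ℝ) (n : ℕ) : ℝ :=
  ∑ k ∈ Finset.Ico 1 n, sigmaR a k * sigmaR b (n - k)

/-- The Riemann zeta function at a real argument (it takes real values there). -/
noncomputable def zetaR (x : ℝ) : ℝ := (riemannZeta (x : ℂ)).re

theorem powlip {a N x y : ℝ} (ha : 1 < a) (hx0 : 0 ≤ x) (hx : x ≤ N) (hy0 : 0 ≤ y) (hy : y ≤ N) :
    |x ^ a - y ^ a| ≤ a * N ^ (a - 1) * |x - y| := by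
  have := Convex.norm_image_sub_le_of_norm_hasDerivWithin_le (𝕜 := ℝ) (f := fun x : ℝ => x ^ a)
    (f' := fun x : ℝ => a * x ^ (a - 1)) (s := Set.Icc 0 N) (C := a * N ^ (a - 1)) (x := y) (y := x)
    (fun x hx => (Real.hasDerivAt_rpow_const (Or.inr ha.le)).hasDerivWithinAt) ?_
    (convex_Icc 0 N) ⟨hy0, hy⟩ ⟨hx0, hx⟩
  · simpa [Real.norm_eq_abs] using this
  · intro z hz
    have h0 : 0 ≤ z ^ (a - 1) := Real.rpow_nonneg hz.1 _
    rw [Real.norm_eq_abs, abs_of_nonneg (by positivity)]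
    have := Real.rpow_le_rpow hz.1 hz.2 (by linarith : 0 ≤ a - 1)
    gcongr

noncomputable def clampR (N x : ℝ) : ℝ := max 0 (min x N)
noncomputable def fF (a b N x : ℝ) : ℝ := clampR N x ^ a * (N - clampR N x) ^ b

theorem clamp_mem {N : ℝ} (hN : 0 ≤ N) (x : ℝ) : 0 ≤ clampR N x ∧ clampR N x ≤ N := by
  unfold clampR; constructor
  · exact le_max_left _ _
  · exact max_le hN (min_le_right _ _)

theorem clamp_lip {N : ℝ} (hN : 0 ≤ N) (x y : ℝ) : |clampR N x - clampR N y| ≤ min |x - y| N := by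
  have h1 := clamp_mem hN x
  have h2 := clamp_mem hN y
  refine le_min ?_ (by rw [abs_le]; constructor <;> linarith)
  unfold clampR
  refine (abs_max_sub_max_le_max _ _ _ _).trans ?_
  simp only [sub_self, abs_zero]
  refine max_le (abs_nonneg _) ((abs_min_sub_min_le_max _ _ _ _).trans ?_)
  simp

theorem fF_cont {a b : ℝ} (ha : 1 < a) (hb : 1 < b) (N : ℝ) : Continuous (fF a b N) := by
  unfold fF clampR
  have h : Continuous fun x : ℝ => max 0 (min x N) := by fun_prop
  exact (h.rpow_const fun _ => Or.inr (by linarith)).mul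
    ((continuous_const.sub h).rpow_const fun _ => Or.inr (by linarith))

theorem fF_lip {a b N : ℝ} (ha : 1 < a) (hb : 1 < b) (hN : 0 < N) (x y : ℝ) :
    |fF a b N x - fF a b N y| ≤ (a + b) * N ^ (a + b - 1) * min |x - y| N := by
  have hx := clamp_mem hN.le x
  have hy := clamp_mem hN.le y
  have hl := clamp_lip hN.le x y
  unfold fF
  set u := clampR N x
  set v := clampR N y
  have h1 := powlip ha hx.1 hx.2 hy.1 hy.2
  have h2 := powlip (x := N - u) (y := N - v) (N := N) hb (by linarith) (by linarith) (by linarith) (by linarith)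
  have e : N - u - (N - v) = -(u - v) := by ring
  rw [e, abs_neg] at h2
  have h3 : (N - u) ^ b ≤ N ^ b := Real.rpow_le_rpow (by linarith) (by linarith) (by linarith)
  have h3' : 0 ≤ (N - u) ^ b := Real.rpow_nonneg (by linarith) _
  have h4 : v ^ a ≤ N ^ a := Real.rpow_le_rpow (by linarith) (by linarith) (by linarith)
  have h4' : 0 ≤ v ^ a := Real.rpow_nonneg (by linarith) _
  have p1 : N ^ (a + b - 1) = N ^ (a - 1) * N ^ b := by rw [← Real.rpow_add hN]; ring_nf
  have p2 : N ^ (a + b - 1) = N ^ (b - 1) * N ^ a := by rw [← Real.rpow_add hN]; ring_nf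
  have e2 : u ^ a * (N - u) ^ b - v ^ a * (N - v) ^ b =
      (u ^ a - v ^ a) * (N - u) ^ b + v ^ a * ((N - u) ^ b - (N - v) ^ b) := by ring
  have hp : 0 ≤ N ^ (a - 1) := by positivity
  have hp' : 0 ≤ N ^ (b - 1) := by positivity
  calc _ ≤ |u ^ a - v ^ a| * (N - u) ^ b + v ^ a * |(N - u) ^ b - (N - v) ^ b| := by
        rw [e2]; refine (abs_add_le _ _).trans ?_
        rw [abs_mul, abs_mul, abs_of_nonneg h3', abs_of_nonneg h4']
    _ ≤ (a * N ^ (a - 1) * |u - v|) * N ^ b + N ^ a * (b * N ^ (b - 1) * |u - v|) := by gcongr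
    _ = (a + b) * N ^ (a + b - 1) * |u - v| := by
        rw [add_mul, add_mul]; nth_rw 1 [p1]; rw [p2]; ring
    _ ≤ _ := by gcongr

theorem fF_bound {a b N : ℝ} (ha : 1 < a) (hb : 1 < b) (hN : 0 < N) (x : ℝ) :
    0 ≤ fF a b N x ∧ fF a b N x ≤ N ^ (a + b) := by
  have hx := clamp_mem hN.le x
  unfold fF
  have h3 : (N - clampR N x) ^ b ≤ N ^ b := Real.rpow_le_rpow (by linarith) (by linarith) (by linarith)
  have h3' : 0 ≤ (N - clampR N x) ^ b := Real.rpow_nonneg (by linarith) _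
  have h4 : clampR N x ^ a ≤ N ^ a := Real.rpow_le_rpow (by linarith) (by linarith) (by linarith)
  have h4' : 0 ≤ clampR N x ^ a := Real.rpow_nonneg (by linarith) _
  refine ⟨by positivity, ?_⟩
  rw [Real.rpow_add hN]; gcongr

theorem fF_eq {a b N x : ℝ} (h0 : 0 ≤ x) (h1 : x ≤ N) : fF a b N x = x ^ a * (N - x) ^ b := by
  simp [fF, clampR, h0, h1]

theorem fF_zero {a b N x : ℝ} (hb : 1 < b) (hN : 0 ≤ N) (h1 : N ≤ x) : fF a b N x = 0 := by
  have : b ≠ 0 := by linarith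
  simp [fF, clampR, h1, hN, this]

/-- Riemann sum comparison along an arithmetic progression. -/
theorem prog_sum {a b : ℝ} (ha : 1 < a) (hb : 1 < b) {n m r : ℕ} (hn : 0 < n) (hm : 0 < m) (hr : r < m) :
    |∑ j ∈ range (n / m + 1), fF a b n (r + j * m : ℝ)
      - (1 / (m : ℝ)) * ∫ x in (0:ℝ)..n, fF a b n x| ≤ (2 * (a + b) + 1) * (n : ℝ) ^ (a + b) := by
  have hN : (0:ℝ) < n := by exact_mod_cast hn
  have hM : (0:ℝ) < m := by exact_mod_cast hm
  have hc := fF_cont ha hb n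
  have hi : ∀ x y, IntervalIntegrable (fF a b n) MeasureTheory.volume x y := fun x y =>
    hc.intervalIntegrable x y
  set q := n / m + 1 with hq
  have hqn : n < r + q * m := by
    have := Nat.lt_div_mul_add (a := n) hm
    rw [hq]; nlinarith
  have hqn' : (n : ℝ) ≤ r + q * m := by exact_mod_cast hqn.le
  -- the integral
  have I1 : ∫ x in (0:ℝ)..n, fF a b n x = (∫ x in (0:ℝ)..r, fF a b n x) +
      ∑ j ∈ range q, ∫ x in (r + j * m : ℝ)..(r + (j + 1 : ℕ) * m : ℝ), fF a b n x := by
    rw [intervalIntegral.sum_integral_adjacent_intervals (a := fun j : ℕ => (r + j * m : ℝ))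
      (fun k _ => hi _ _)]
    have : ∫ x in (n:ℝ)..(r + q * m : ℝ), fF a b n x = 0 := by
      rw [intervalIntegral.integral_congr (g := fun _ => 0)]
      · simp
      · intro x hx
        rw [Set.uIcc_of_le hqn'] at hx
        exact fF_zero hb hN.le hx.1
    rw [← add_zero (∫ x in (0:ℝ)..n, fF a b n x), ← this,
      intervalIntegral.integral_add_adjacent_intervals (hi _ _) (hi _ _)]
    simp only [Nat.cast_zero, zero_mul, add_zero]
    rw [intervalIntegral.integral_add_adjacent_intervals (hi _ _) (hi _ _)]
  have I2 : |∫ x in (0:ℝ)..r, fF a b n x| ≤ (n:ℝ) ^ (a + b) * m := by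
    have := intervalIntegral.norm_integral_le_of_norm_le_const (a := (0:ℝ)) (b := r)
      (f := fF a b n) (C := (n:ℝ) ^ (a + b)) (fun x _ => by
        have := fF_bound ha hb hN x
        rw [Real.norm_eq_abs, abs_of_nonneg this.1]; exact this.2)
    rw [Real.norm_eq_abs] at this
    refine this.trans ?_
    have : (r : ℝ) ≤ m := by exact_mod_cast hr.le
    rw [sub_zero, abs_of_nonneg (by positivity)]
    gcongr
  set D := (a + b) * (n:ℝ) ^ (a + b - 1) * min (m:ℝ) n with hD
  have I3 : ∀ j ∈ range q, |fF a b n (r + j * m : ℝ) -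
      (1 / (m : ℝ)) * ∫ x in (r + j * m : ℝ)..(r + (j + 1 : ℕ) * m : ℝ), fF a b n x| ≤ D := by
    intro j _
    have hle : (r + j * m : ℝ) ≤ (r + (j + 1 : ℕ) * m : ℝ) := by push_cast; nlinarith
    have hlen : (r + (j + 1 : ℕ) * m : ℝ) - (r + j * m : ℝ) = m := by push_cast; ring
    have e1 : fF a b n (r + j * m : ℝ) -
      (1 / (m : ℝ)) * ∫ x in (r + j * m : ℝ)..(r + (j + 1 : ℕ) * m : ℝ), fF a b n x
      = (1 / (m:ℝ)) * ∫ x in (r + j * m : ℝ)..(r + (j + 1 : ℕ) * m : ℝ), (fF a b n (r + j * m : ℝ) - fF a b n x) := by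
      rw [intervalIntegral.integral_sub (by simp) (hi _ _), intervalIntegral.integral_const, hlen, smul_eq_mul]
      field_simp
    rw [e1, abs_mul, abs_of_pos (by positivity : 0 < 1 / (m:ℝ))]
    have := intervalIntegral.norm_integral_le_of_norm_le_const (a := (r + j * m : ℝ)) (b := (r + (j + 1 : ℕ) * m : ℝ))
      (f := fun x => fF a b n (r + j * m : ℝ) - fF a b n x) (C := D) (fun x hx => by
        rw [Set.uIoc_of_le hle] at hx
        rw [Real.norm_eq_abs]
        refine (fF_lip ha hb hN _ _).trans ?_
        rw [hD]
        have : |(r + j * m : ℝ) - x| ≤ m := by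
          rw [abs_le]; constructor <;> linarith [hx.1, hx.2]
        gcongr)
    rw [Real.norm_eq_abs, hlen, abs_of_pos hM] at this
    calc _ ≤ (1 / (m:ℝ)) * (D * m) := by gcongr
      _ = D := by field_simp
  have hqD : q * D ≤ 2 * (a + b) * (n:ℝ) ^ (a + b) := by
    have hq1 : (q:ℝ) ≤ n / m + 1 := by
      rw [hq]; push_cast; gcongr; exact Nat.cast_div_le
    have hmin0 : 0 ≤ min (m:ℝ) n := by positivity
    have h1 : (q:ℝ) * min (m:ℝ) n ≤ 2 * n := by
      calc _ ≤ ((n:ℝ) / m + 1) * min (m:ℝ) n := by gcongr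
        _ = (n:ℝ) / m * min (m:ℝ) n + min (m:ℝ) n := by ring
        _ ≤ (n:ℝ) / m * m + n := by gcongr; exact min_le_left _ _; exact min_le_right _ _
        _ = _ := by field_simp; ring
    have hp : (n:ℝ) ^ (a + b) = (n:ℝ) ^ (a + b - 1) * n := by
      rw [← Real.rpow_add_one hN.ne']; ring_nf
    calc _ = (a + b) * (n:ℝ) ^ (a + b - 1) * (q * min (m:ℝ) n) := by rw [hD]; ring
      _ ≤ (a + b) * (n:ℝ) ^ (a + b - 1) * (2 * n) := by gcongr
      _ = _ := by rw [hp]; ring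
  have e : ∑ j ∈ range q, fF a b n (r + j * m : ℝ) - (1 / (m : ℝ)) * ∫ x in (0:ℝ)..n, fF a b n x
     = ∑ j ∈ range q, (fF a b n (r + j * m : ℝ) -
      (1 / (m : ℝ)) * ∫ x in (r + j * m : ℝ)..(r + (j + 1 : ℕ) * m : ℝ), fF a b n x)
      - (1 / (m : ℝ)) * ∫ x in (0:ℝ)..r, fF a b n x := by
    rw [I1, sum_sub_distrib, ← mul_sum]; ring
  rw [e]
  calc _ ≤ _ := abs_sub _ _
    _ ≤ q * D + (n:ℝ) ^ (a + b) := by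
      gcongr
      · refine (abs_sum_le_sum_abs _ _).trans ((sum_le_sum I3).trans ?_)
        simp
      · rw [abs_mul, abs_of_pos (by positivity : 0 < 1 / (m:ℝ))]
        calc _ ≤ (1 / (m:ℝ)) * ((n:ℝ) ^ (a + b) * m) := by gcongr
          _ = _ := by field_simp
    _ ≤ _ := by linarith

theorem fF_integral {a b : ℝ} (ha : 1 < a) (hb : 1 < b) {N : ℝ} (hN : 0 < N) :
    ∫ x in (0:ℝ)..N, fF a b N x =
      (Real.Gamma (a + 1) * Real.Gamma (b + 1) / Real.Gamma (a + b + 2)) * N ^ (a + b + 1) := by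
  have h1 := Complex.betaIntegral_scaled (↑(a + 1)) (↑(b + 1)) hN
  have h2 := Complex.Gamma_mul_Gamma_eq_betaIntegral (s := ↑(a + 1)) (t := ↑(b + 1))
    (by rw [Complex.ofReal_re]; linarith) (by rw [Complex.ofReal_re]; linarith)
  have hG : Real.Gamma (a + b + 2) ≠ 0 := (Real.Gamma_pos_of_pos (by linarith)).ne'
  have e1 : ((∫ x in (0:ℝ)..N, fF a b N x : ℝ) : ℂ) =
      ∫ x in (0:ℝ)..N, (x:ℂ) ^ ((↑(a + 1) : ℂ) - 1) * ((N:ℂ) - x) ^ ((↑(b + 1) : ℂ) - 1) := by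
    rw [← intervalIntegral.integral_ofReal]
    refine intervalIntegral.integral_congr ?_
    intro x hx
    rw [Set.uIcc_of_le hN.le] at hx
    simp only
    rw [fF_eq hx.1 hx.2, Complex.ofReal_mul, Complex.ofReal_cpow hx.1, Complex.ofReal_cpow (by linarith [hx.2])]
    push_cast
    ring_nf
  rw [← e1] at h1
  have e2 : (↑(a + 1) : ℂ) + ↑(b + 1) = ((a + b + 2 : ℝ) : ℂ) := by push_cast; ring
  have e3 : (N : ℂ) ^ ((↑(a + 1) : ℂ) + ↑(b + 1) - 1) = ((N ^ (a + b + 1) : ℝ) : ℂ) := by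
    rw [Complex.ofReal_cpow hN.le]; push_cast; ring_nf
  rw [e2] at h2
  rw [e3] at h1
  simp only [Complex.Gamma_ofReal] at h2
  have : (((∫ x in (0:ℝ)..N, fF a b N x) * Real.Gamma (a + b + 2) : ℝ) : ℂ) =
    ((Real.Gamma (a + 1) * Real.Gamma (b + 1) * N ^ (a + b + 1) : ℝ) : ℂ) := by
    rw [Complex.ofReal_mul, h1]; push_cast; push_cast at h2; rw [h2]; ring
  have := Complex.ofReal_injective this
  field_simp
  linarith

theorem fF_zero' {a b N : ℝ} (ha : 1 < a) : fF a b N 0 = 0 ∨ N < 0 := by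
  by_cases hN : 0 ≤ N
  · left
    have : a ≠ 0 := by linarith
    rw [fF_eq le_rfl hN, Real.zero_rpow this, zero_mul]
  · right; linarith

noncomputable def TT (a b : ℝ) (n d e : ℕ) : ℝ :=
  ∑ k ∈ Ico 1 n, if d ∣ k ∧ e ∣ (n - k) then fF a b n k else 0

theorem crt_iff {n d e k k0 : ℕ} (h1 : k0 ≡ 0 [MOD d]) (h2 : k0 ≡ n [MOD e]) (hk : k ≤ n) :
    (d ∣ k ∧ e ∣ (n - k)) ↔ k ≡ k0 [MOD (d.lcm e)] := by
  have c1 : d ∣ k ↔ k ≡ k0 [MOD d] := by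
    rw [← Nat.modEq_zero_iff_dvd]
    exact ⟨fun h => h.trans h1.symm, fun h => h.trans h1⟩
  have c2 : e ∣ (n - k) ↔ k ≡ k0 [MOD e] := by
    rw [← Nat.modEq_iff_dvd' hk]
    exact ⟨fun h => h.trans h2.symm, fun h => h.trans h2⟩
  rw [c1, c2, Nat.modEq_iff_dvd, Nat.modEq_iff_dvd, Nat.modEq_iff_dvd]
  constructor
  · rintro ⟨x, y⟩
    rw [Int.natCast_dvd] at x y ⊢
    exact Nat.lcm_dvd x y
  · intro x
    rw [Int.natCast_dvd] at x ⊢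
    rw [Int.natCast_dvd]
    exact ⟨(Nat.dvd_lcm_left d e).trans x, (Nat.dvd_lcm_right d e).trans x⟩

theorem TT_eq {a b : ℝ} (ha : 1 < a) (hb : 1 < b) {n d e k0 : ℕ} (hd : 0 < d) (he : 0 < e)
    (h1 : k0 ≡ 0 [MOD d]) (h2 : k0 ≡ n [MOD e]) :
    TT a b n d e = ∑ j ∈ range (n / d.lcm e + 1),
      fF a b n ((k0 % d.lcm e : ℕ) + j * (d.lcm e : ℕ) : ℝ) := by
  have hm : 0 < d.lcm e := Nat.lcm_pos hd he
  set m := d.lcm e with hmdef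
  set r := k0 % m with hr
  have hinj : Set.InjOn (fun j : ℕ => r + j * m) (range (n / m + 1) : Finset ℕ) := by
    intro x _ y _ h
    simp only [add_right_inj] at h
    exact Nat.eq_of_mul_eq_mul_right hm h
  have e1 : ∑ j ∈ range (n / m + 1), fF a b n ((r : ℕ) + j * (m : ℕ) : ℝ) =
      ∑ k ∈ (range (n / m + 1)).image (fun j : ℕ => r + j * m), fF a b n (k : ℝ) := by
    rw [sum_image hinj]; push_cast; rfl
  rw [e1, TT, ← sum_filter]
  apply sum_subset
  · intro k hk
    rw [mem_filter, mem_Ico] at hk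
    obtain ⟨⟨hk1, hk2⟩, hk3⟩ := hk
    rw [crt_iff h1 h2 hk2.le] at hk3
    rw [mem_image]
    refine ⟨k / m, ?_, ?_⟩
    · rw [mem_range]
      have := Nat.div_le_div_right (c := m) hk2.le
      omega
    · have : k % m = r := hk3
      rw [← this, mul_comm]; exact Nat.mod_add_div k m
  · intro k hk hk'
    rw [mem_image] at hk
    obtain ⟨j, -, hj⟩ := hk
    rcases Nat.eq_zero_or_pos k with h0 | h0
    · rw [h0, Nat.cast_zero]
      rcases fF_zero' (a := a) (b := b) (N := n) ha with h | h
      · exact h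
      · have : (0:ℝ) ≤ n := by positivity
        linarith
    rcases le_or_gt n k with hn | hn
    · exact fF_zero hb (by positivity) (by exact_mod_cast hn)
    · exfalso
      apply hk'
      rw [mem_filter, mem_Ico, crt_iff h1 h2 hn.le]
      refine ⟨⟨h0, hn⟩, ?_⟩
      show k % m = k0 % m
      rw [← hj, Nat.add_mul_mod_self_right, hr, Nat.mod_mod]

theorem TT_bound {a b : ℝ} (ha : 1 < a) (hb : 1 < b) {n d e : ℕ} (hn : 0 < n) (hd : 0 < d) (he : 0 < e) :
    |TT a b n d e - (if d.gcd e ∣ n then 1 / (d.lcm e : ℝ) else 0) * ∫ x in (0:ℝ)..n, fF a b n x|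
      ≤ (2 * (a + b) + 1) * (n : ℝ) ^ (a + b) := by
  split_ifs with hg
  · have hc : 0 ≡ n [MOD d.gcd e] := ((Nat.modEq_zero_iff_dvd).2 hg).symm
    obtain ⟨k0, h1, h2⟩ := Nat.chineseRemainder' hc
    rw [TT_eq ha hb hd he h1 h2]
    exact prog_sum ha hb hn (Nat.lcm_pos hd he) (Nat.mod_lt _ (Nat.lcm_pos hd he))
  · have : TT a b n d e = 0 := by
      apply sum_eq_zero
      intro k hk
      rw [mem_Ico] at hk
      rw [if_neg]
      rintro ⟨h1, h2⟩
      apply hg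
      have := Nat.dvd_add ((Nat.gcd_dvd_left d e).trans h1) ((Nat.gcd_dvd_right d e).trans h2)
      rwa [Nat.add_sub_cancel' hk.2.le] at this
    rw [this, zero_mul, sub_zero, abs_zero]
    have : 0 < a + b := by linarith
    positivity

theorem sigma_neg (a : ℝ) {k : ℕ} (hk : 0 < k) :
    sigmaR a k = (k:ℝ) ^ a * ∑ d ∈ k.divisors, (d:ℝ) ^ (-a) := by
  unfold sigmaR
  rw [← Nat.sum_div_divisors, mul_sum]
  apply sum_congr rfl
  intro d hd
  have hdk := Nat.dvd_of_mem_divisors hd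
  have hd0 : (0:ℝ) < d := by exact_mod_cast Nat.pos_of_mem_divisors hd
  rw [Nat.cast_div hdk hd0.ne', Real.div_rpow (by positivity) hd0.le, Real.rpow_neg hd0.le]
  rfl

noncomputable def wt (s t : ℝ) (p : ℕ × ℕ) : ℝ := (p.1 : ℝ) ^ (-s) * (p.2 : ℝ) ^ (-t)

theorem wt_nonneg (s t : ℝ) (p : ℕ × ℕ) : 0 ≤ wt s t p := by unfold wt; positivity

theorem wt_summable {s t : ℝ} (hs : 1 < s) (ht : 1 < t) : Summable (wt s t) := by
  have h1 : Summable (fun n : ℕ => (n:ℝ) ^ (-s)) := Real.summable_nat_rpow.2 (by linarith)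
  have h2 : Summable (fun n : ℕ => (n:ℝ) ^ (-t)) := Real.summable_nat_rpow.2 (by linarith)
  exact h1.mul_of_nonneg h2 (fun _ => by positivity) (fun _ => by positivity)

theorem zetaR_eq {s : ℝ} (hs : 1 < s) : zetaR s = ∑' n : ℕ, (n:ℝ) ^ (-s) := by
  unfold zetaR
  rw [zeta_eq_tsum_one_div_nat_cpow (by simpa using hs)]
  have : (∑' n : ℕ, 1 / (n:ℂ) ^ (s:ℂ)) = ((∑' n : ℕ, (n:ℝ) ^ (-s) : ℝ) : ℂ) := by
    rw [Complex.ofReal_tsum]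
    congr 1; ext n
    rw [Real.rpow_neg (by positivity), Complex.ofReal_inv, Complex.ofReal_cpow (by positivity)]
    simp
  rw [this, Complex.ofReal_re]

theorem zetaR_pos {s : ℝ} (hs : 1 < s) : 0 < zetaR s := by
  rw [zetaR_eq hs]
  exact (Real.summable_nat_rpow.2 (by linarith)).tsum_pos (fun _ => by positivity) 1 (by simp)

theorem wt_tsum {s t : ℝ} (hs : 1 < s) (ht : 1 < t) : HasSum (wt s t) (zetaR s * zetaR t) := by
  have h1 : Summable (fun n : ℕ => (n:ℝ) ^ (-s)) := Real.summable_nat_rpow.2 (by linarith)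
  have h2 : Summable (fun n : ℕ => (n:ℝ) ^ (-t)) := Real.summable_nat_rpow.2 (by linarith)
  rw [zetaR_eq hs, zetaR_eq ht]
  exact h1.hasSum.mul h2.hasSum (wt_summable hs ht)

noncomputable def QQ (s t : ℝ) (g : ℕ) : ℝ := ∑' p : ℕ × ℕ, if p.1.gcd p.2 = g then wt s t p else 0

theorem QQ_scale {s t : ℝ} (hs : 1 < s) (ht : 1 < t) (g : ℕ) :
    QQ s t g = (g:ℝ) ^ (-(s + t)) * QQ s t 1 := by
  rcases Nat.eq_zero_or_pos g with h0 | hg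
  · subst h0
    rw [Nat.cast_zero, Real.zero_rpow (by linarith), zero_mul, QQ]
    convert tsum_zero with p
    split_ifs with h
    · rw [Nat.gcd_eq_zero_iff] at h
      simp only [wt, h.1, h.2]
      rw [Nat.cast_zero, Real.zero_rpow (by linarith), zero_mul]
    · rfl
  · have hg' : (0:ℝ) < g := by exact_mod_cast hg
    have hinj : Function.Injective (fun p : ℕ × ℕ => (g * p.1, g * p.2)) := by
      intro p q h
      simp only [Prod.mk.injEq] at h
      exact Prod.ext (Nat.eq_of_mul_eq_mul_left hg h.1) (Nat.eq_of_mul_eq_mul_left hg h.2)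
    unfold QQ
    rw [← hinj.tsum_eq, ← tsum_mul_left]
    · congr 1; ext p
      simp only [Nat.gcd_mul_left]
      have : g * p.1.gcd p.2 = g ↔ p.1.gcd p.2 = 1 := by
        constructor
        · intro h; exact Nat.eq_of_mul_eq_mul_left hg (by rw [h, mul_one])
        · intro h; rw [h, mul_one]
      simp only [this, wt]
      split_ifs
      · push_cast
        rw [Real.mul_rpow (by positivity) (by positivity), Real.mul_rpow (by positivity) (by positivity),
          neg_add, Real.rpow_add hg']
        ring
      · simp
    · intro p hp
      rw [Function.mem_support] at hp
      have hgp : p.1.gcd p.2 = g := by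
        by_contra h; exact hp (if_neg h)
      refine ⟨(p.1 / g, p.2 / g), ?_⟩
      ext
      · exact Nat.mul_div_cancel' (hgp ▸ Nat.gcd_dvd_left _ _)
      · exact Nat.mul_div_cancel' (hgp ▸ Nat.gcd_dvd_right _ _)

theorem QQ_one {s t : ℝ} (hs : 1 < s) (ht : 1 < t) :
    QQ s t 1 = zetaR s * zetaR t / zetaR (s + t) := by
  have h := (wt_tsum hs ht).tsum_fiberwise (fun p => p.1.gcd p.2)
  have e : (fun c : ℕ => ∑' p : (fun p : ℕ × ℕ => p.1.gcd p.2) ⁻¹' {c}, wt s t p) =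
      fun g : ℕ => (g:ℝ) ^ (-(s + t)) * QQ s t 1 := by
    ext g
    rw [← QQ_scale hs ht, _root_.tsum_subtype, QQ]
    refine tsum_congr fun p => ?_
    by_cases hp : p.1.gcd p.2 = g
    · rw [if_pos hp, Set.indicator_of_mem (show p ∈ (fun p : ℕ × ℕ => p.1.gcd p.2) ⁻¹' {g} from hp)]
    · rw [if_neg hp, Set.indicator_of_notMem (show p ∉ (fun p : ℕ × ℕ => p.1.gcd p.2) ⁻¹' {g} from hp)]
  rw [e] at h
  have h2 := h.tsum_eq
  rw [tsum_mul_right, ← zetaR_eq (by linarith)] at h2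
  rw [← h2]
  have := zetaR_pos (s := s + t) (by linarith)
  field_simp

theorem main_arith {a b : ℝ} (ha : 1 < a) (hb : 1 < b) {n : ℕ} (hn : 0 < n) :
    HasSum (fun p : ℕ × ℕ => wt a b p * (if p.1.gcd p.2 ∣ n then 1 / (p.1.lcm p.2 : ℝ) else 0))
      ((zetaR (a + 1) * zetaR (b + 1) / zetaR (a + b + 2)) * ∑ g ∈ n.divisors, (g:ℝ) ^ (-(a + b + 1))) := by
  have hs : 1 < a + 1 := by linarith
  have ht : 1 < b + 1 := by linarith
  have hQ : ∀ g : ℕ, HasSum (fun p : ℕ × ℕ => (g:ℝ) * if p.1.gcd p.2 = g then wt (a + 1) (b + 1) p else 0)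
      ((g:ℝ) * QQ (a + 1) (b + 1) g) := by
    intro g
    refine (Summable.hasSum ?_).mul_left _
    refine (wt_summable hs ht).of_nonneg_of_le (fun p => ?_) (fun p => ?_)
    · split_ifs; exact wt_nonneg _ _ _; exact le_rfl
    · split_ifs; exact le_rfl; exact wt_nonneg _ _ _
  have := hasSum_sum (s := n.divisors) (fun g _ => hQ g)
  convert this using 1
  · ext p
    have hsimp : ∀ g : ℕ, (g:ℝ) * (if p.1.gcd p.2 = g then wt (a + 1) (b + 1) p else 0) =
      if p.1.gcd p.2 = g then (p.1.gcd p.2 : ℝ) * wt (a + 1) (b + 1) p else 0 := by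
      intro g; split_ifs with h
      · rw [h]
      · simp
    simp only [hsimp]
    rw [sum_ite_eq]
    simp only [Nat.mem_divisors, hn.ne', ne_eq, not_false_eq_true, and_true]
    split_ifs with h
    · obtain ⟨d, e⟩ := p
      simp only [wt]
      rcases Nat.eq_zero_or_pos d with hd | hd
      · subst hd
        simp [Real.zero_rpow (by linarith : -a ≠ 0), Real.zero_rpow (by linarith : -1 + -a ≠ 0)]
      rcases Nat.eq_zero_or_pos e with he | he
      · subst he
        simp [Real.zero_rpow (by linarith : -b ≠ 0), Real.zero_rpow (by linarith : -1 + -b ≠ 0)]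
      have hd' : (0:ℝ) < d := by exact_mod_cast hd
      have he' : (0:ℝ) < e := by exact_mod_cast he
      have hl : (0:ℝ) < d.lcm e := by exact_mod_cast Nat.lcm_pos hd he
      have hgl : (d.gcd e : ℝ) * (d.lcm e : ℝ) = d * e := by exact_mod_cast Nat.gcd_mul_lcm d e
      have x1 : (d:ℝ) ^ (-(a + 1)) = (d:ℝ) ^ (-a) / d := by
        rw [← Real.rpow_sub_one hd'.ne']; ring_nf
      have x2 : (e:ℝ) ^ (-(b + 1)) = (e:ℝ) ^ (-b) / e := by
        rw [← Real.rpow_sub_one he'.ne']; ring_nf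
      rw [x1, x2]
      field_simp
      linarith
    · simp
  · have e0 : a + b + 2 = (a + 1) + (b + 1) := by ring
    rw [e0, ← QQ_one hs ht, mul_sum]
    apply sum_congr rfl
    intro g hg
    have hg0 : (0:ℝ) < g := by exact_mod_cast Nat.pos_of_mem_divisors hg
    rw [QQ_scale hs ht g]
    have : (g:ℝ) ^ (-(a + b + 1)) = (g:ℝ) ^ (-(a + 1 + (b + 1))) * g := by
      rw [← Real.rpow_add_one hg0.ne']; ring_nf
    rw [this]; ring

theorem SR_hasSum {a b : ℝ} (n : ℕ) :
    HasSum (fun p : ℕ × ℕ => wt a b p * TT a b n p.1 p.2) (SR a b n) := by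
  have h : ∀ k ∈ Ico 1 n, HasSum (fun p : ℕ × ℕ => wt a b p *
      (if p.1 ∣ k ∧ p.2 ∣ (n - k) then fF a b n k else 0)) (sigmaR a k * sigmaR b (n - k)) := by
    intro k hk
    rw [mem_Ico] at hk
    have e : sigmaR a k * sigmaR b (n - k) = ∑ p ∈ k.divisors ×ˢ (n - k).divisors, wt a b p *
      (if p.1 ∣ k ∧ p.2 ∣ (n - k) then fF a b n k else 0) := by
      rw [sigma_neg a (by omega), sigma_neg b (by omega : 0 < n - k), Nat.cast_sub hk.2.le]
      rw [mul_mul_mul_comm, sum_mul_sum, ← sum_product', mul_sum,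
        ← fF_eq (by positivity) (by exact_mod_cast hk.2.le)]
      apply sum_congr rfl
      intro p hp
      rw [mem_product, Nat.mem_divisors, Nat.mem_divisors] at hp
      rw [if_pos ⟨hp.1.1, hp.2.1⟩, wt, mul_comm]
    rw [e]
    apply hasSum_sum_of_ne_finset_zero
    intro p hp
    rw [if_neg, mul_zero]
    rintro ⟨h1, h2⟩
    apply hp
    rw [mem_product, Nat.mem_divisors, Nat.mem_divisors]
    exact ⟨⟨h1, by omega⟩, ⟨h2, by omega⟩⟩
  have := hasSum_sum h
  simpa only [TT, mul_sum, SR] using this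

theorem stmt15 (a b : ℝ) (ha : 1 < a) (hb : 1 < b) :
    ∃ C : ℝ, ∀ n : ℕ, 2 ≤ n →
      |SR a b n
        - (Real.Gamma (a + 1) * Real.Gamma (b + 1) / Real.Gamma (a + b + 2))
            * (zetaR (a + 1) * zetaR (b + 1) / zetaR (a + b + 2)) * sigmaR (a + b + 1) n|
      ≤ C * (n : ℝ) ^ (a + b) := by
  refine ⟨(zetaR a * zetaR b) * (2 * (a + b) + 1), fun n hn => ?_⟩
  have hn0 : 0 < n := by omega
  have hN : (0:ℝ) < n := by exact_mod_cast hn0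
  have H := (SR_hasSum (a := a) (b := b) n).sub ((main_arith ha hb hn0).mul_right (∫ x in (0:ℝ)..n, fF a b n x))
  have e : SR a b n - (Real.Gamma (a + 1) * Real.Gamma (b + 1) / Real.Gamma (a + b + 2))
            * (zetaR (a + 1) * zetaR (b + 1) / zetaR (a + b + 2)) * sigmaR (a + b + 1) n =
      SR a b n - (zetaR (a + 1) * zetaR (b + 1) / zetaR (a + b + 2)) *
        (∑ g ∈ n.divisors, (g:ℝ) ^ (-(a + b + 1))) * ∫ x in (0:ℝ)..n, fF a b n x := by
    rw [fF_integral ha hb hN, sigma_neg _ hn0]; ring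
  rw [e, ← H.tsum_eq, ← Real.norm_eq_abs, mul_assoc]
  refine tsum_of_norm_bounded ((wt_tsum ha hb).mul_right _) ?_
  rintro ⟨d, e⟩
  rw [mul_assoc, ← mul_sub, norm_mul, Real.norm_eq_abs, Real.norm_eq_abs, abs_of_nonneg (wt_nonneg _ _ _)]
  rcases Nat.eq_zero_or_pos d with hd | hd
  · subst hd
    simp [wt, Real.zero_rpow (by linarith : -a ≠ 0)]
  rcases Nat.eq_zero_or_pos e with he | he
  · subst he
    simp [wt, Real.zero_rpow (by linarith : -b ≠ 0)]
  exact mul_le_mul_of_nonneg_left (TT_bound ha hb hn0 hd he) (wt_nonneg _ _ _)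
end
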